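/- There exists ε₀ > 0 such that for every ε ∈ (0, ε₀] the following holds. Suppose ℝ² × ℝ carries a metric space structure whose distance is d(p,q) = max(‖q₁−p₁‖, ε·|q₂ − p₂ − 2ω(p₁,q₁)|^{1/2}) (the left-invariant smooth-box distance of the first Heisenberg group), where ‖·‖ is the Euclidean norm on ℝ² and ω((a,b),(c,d)) = ad − bc. Let α > 0 and let E ⊆ ℝ² × ℝ be a Borel set with 0 < H^α_d(E) < ∞ such that Θ^α_d(E,x) = 1 for H^α_d-almost every x ∈ E. Then α = 1 and E can be covered, up to an H^1_d-null set, by countably many Lipschitz images of compact subsets of ℝ. -/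

import Mathlib

open MeasureTheory Filter
open scoped ENNReal NNReal

/-- The first Heisenberg group `ℝ² × ℝ` as a bare type. -/
def Heis : Type := (ℝ × ℝ) × ℝ

/-- First-layer (horizontal) component. -/
noncomputable def Heis.h (p : Heis) : ℝ × ℝ := p.1

/-- Second-layer (vertical) component. -/
noncomputable def Heis.v (p : Heis) : ℝ := p.2

/-- The standard symplectic form `ω((a,b),(c,d)) = ad - bc` on `ℝ²`. -/
noncomputable def Heis.omega (a b : ℝ × ℝ) : ℝ := a.1 * b.2 - a.2 * b.1

/-- The Euclidean norm on `ℝ²`. -/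
noncomputable def Heis.enorm2 (a : ℝ × ℝ) : ℝ := Real.sqrt (a.1 ^ 2 + a.2 ^ 2)

/-- The distance function of a metric-space structure on `Heis`. -/
noncomputable def Heis.dist' (m : MetricSpace Heis) (p q : Heis) : ℝ :=
  letI := m; dist p q

/-- The Borel σ-algebra of a metric-space structure on `Heis`. -/
noncomputable def Heis.borelMS (m : MetricSpace Heis) : MeasurableSpace Heis :=
  letI := m; borel Heis

/-- The `α`-dimensional Hausdorff measure for a metric-space structure on `Heis`. -/
noncomputable def Heis.hausdorff (m : MetricSpace Heis) (α : ℝ) :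
    @Measure Heis (Heis.borelMS m) :=
  letI := m
  letI : MeasurableSpace Heis := Heis.borelMS m
  haveI : BorelSpace Heis := ⟨rfl⟩
  μH[α]

/-- Closed ball for a metric-space structure on `Heis`. -/
def Heis.cball (m : MetricSpace Heis) (x : Heis) (r : ℝ) : Set Heis :=
  letI := m; Metric.closedBall x r

/-- `f` is `K`-Lipschitz on `A ⊆ ℝ` as a map into `(Heis, m)`. -/
def Heis.lipOn (m : MetricSpace Heis) (K : ℝ≥0) (f : ℝ → Heis) (A : Set ℝ) : Prop :=
  letI := m; LipschitzOnWith K f A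

section Helpers
open Metric
open scoped Topology

theorem hd_cover {X : Type*} [MetricSpace X] [MeasurableSpace X] [BorelSpace X]
    {α : ℝ} (hα : 0 < α) (μ : Measure X) [IsFiniteMeasure μ]
    {lam : ℝ≥0∞} (hl : 1 < lam) (hl' : lam ≠ ⊤) {Z V : Set X} (hV : IsOpen V) (hZV : Z ⊆ V)
    (hZ : ∀ x ∈ Z, ∀ r : ℝ≥0∞, 0 < r → ∃ S, IsClosed S ∧ x ∈ S ∧ ediam S < r ∧
      lam * ediam S ^ α < μ S) (r : ℝ≥0∞) (hr : 0 < r) (hr' : r ≠ ⊤) (ζ : ℝ≥0∞) (hζ : 0 < ζ) :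
    ∃ (u : Set (Set X)) (t : u → Set X), u.Countable ∧ (∀ i, ediam (t i) ≤ r) ∧ Z ⊆ ⋃ i, t i ∧
      ∑' i, ediam (t i) ^ α ≤ lam⁻¹ * μ V + ζ := by
  classical
  have hr5 : 0 < r / 5 := ENNReal.div_pos hr.ne' (by norm_num)
  have hr5' : r / 5 ≠ ⊤ := ENNReal.div_ne_top hr' (by norm_num)
  have hr5r : 5 * (r / 5) = r := ENNReal.mul_div_cancel (by norm_num) (by norm_num)
  set T : Set (Set X) := {S | IsClosed S ∧ (S ∩ Z).Nonempty ∧ S ⊆ V ∧ ediam S ≤ r / 5 ∧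
    lam * ediam S ^ α < μ S} with hT
  have hfin : ∀ S ∈ T, ediam S ≠ ⊤ := fun S hS => ne_top_of_le_ne_top hr5' hS.2.2.2.1
  obtain ⟨u, huT, hdisj, hcov⟩ := Vitali.exists_disjoint_subfamily_covering_enlargement
    (fun S : Set X => S) T (fun S => (ediam S).toReal) 2 one_lt_two
    (fun S _ => ENNReal.toReal_nonneg) (r / 5).toReal
    (fun S hS => ENNReal.toReal_mono hr5' hS.2.2.2.1)
    (fun S hS => hS.2.1.mono Set.inter_subset_left)
  have hdisj' : Pairwise (Function.onFun Disjoint (fun i : u => (i : Set X))) := by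
    intro i j hij
    exact hdisj i.2 j.2 (fun h => hij (Subtype.ext h))
  have hmeas : ∀ i : u, MeasurableSet (i : Set X) := fun i => (huT i.2).1.measurableSet
  have hpos : ∀ i : u, 0 < μ (i : Set X) := fun i => (zero_le).trans_lt (huT i.2).2.2.2.2
  have hucount : u.Countable := by
    have := Measure.countable_meas_pos_of_disjoint_iUnion (μ := μ) hmeas hdisj'
    have h2 : {i : u | 0 < μ (i : Set X)} = Set.univ := by ext i; simp [hpos i]
    rw [h2, Set.countable_univ_iff] at this
    exact Set.countable_coe_iff.mp this
  have : Countable u := hucount.to_subtype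
  have hlam0 : lam ≠ 0 := (zero_lt_one.trans hl).ne'
  have hsum : ∑' i : u, ediam (i : Set X) ^ α ≤ lam⁻¹ * μ V := by
    calc ∑' i : u, ediam (i : Set X) ^ α ≤ ∑' i : u, lam⁻¹ * μ (i : Set X) := by
          refine ENNReal.tsum_le_tsum fun i => ?_
          rw [mul_comm, ← div_eq_mul_inv, ENNReal.le_div_iff_mul_le (Or.inl hlam0) (Or.inl hl'),
            mul_comm]
          exact (huT i.2).2.2.2.2.le
      _ = lam⁻¹ * μ (⋃ i : u, (i : Set X)) := by
          rw [ENNReal.tsum_mul_left, measure_iUnion hdisj' hmeas]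
      _ ≤ lam⁻¹ * μ V := by
          gcongr
          exact Set.iUnion_subset fun i => (huT i.2).2.2.1
  have hsumfin : ∑' i : u, ediam (i : Set X) ^ α ≠ ⊤ :=
    ne_top_of_le_ne_top (ENNReal.mul_ne_top (ENNReal.inv_ne_top.2 hlam0) (measure_ne_top _ _)) hsum
  have h5 : (5 : ℝ≥0∞) ^ α ≠ ⊤ := ENNReal.rpow_ne_top_of_nonneg hα.le (by norm_num)
  have htail := ENNReal.tendsto_tsum_compl_atTop_zero hsumfin
  have htail2 := ENNReal.Tendsto.const_mul (a := (5 : ℝ≥0∞) ^ α) htail (Or.inr h5)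
  rw [mul_zero] at htail2
  obtain ⟨F, hF⟩ := (htail2.eventually (gt_mem_nhds hζ)).exists
  set N : Set X → Set X := fun S => ⋃ x ∈ S, closedBall x (2 * (ediam S).toReal) with hN
  have hNd : ∀ S ∈ T, ediam (N S) ≤ 5 * ediam S := by
    intro S hS
    refine ediam_le fun a ha b hb => ?_
    simp only [hN, Set.mem_iUnion, exists_prop] at ha hb
    obtain ⟨x, hx, hxa⟩ := ha
    obtain ⟨y, hy, hyb⟩ := hb
    rw [edist_dist]
    have hxy : dist x y ≤ (ediam S).toReal := by
      rw [dist_edist]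
      exact ENNReal.toReal_mono (hfin S hS) (edist_le_ediam_of_mem hx hy)
    have : dist a b ≤ 5 * (ediam S).toReal := by
      rw [mem_closedBall] at hxa hyb
      have := dist_triangle4 a x y b
      rw [dist_comm y b] at this
      linarith
    calc ENNReal.ofReal (dist a b) ≤ ENNReal.ofReal (5 * (ediam S).toReal) :=
          ENNReal.ofReal_le_ofReal this
      _ = 5 * ediam S := by
          rw [ENNReal.ofReal_mul (by norm_num), ENNReal.ofReal_toReal (hfin S hS)]; norm_num
  refine ⟨u, fun i => if i ∈ F then (i : Set X) else N i, hucount, ?_, ?_, ?_⟩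
  · intro i
    have h1 := (huT i.2).2.2.2.1
    dsimp only
    split_ifs
    · refine h1.trans ?_
      calc r / 5 = 1 * (r / 5) := (one_mul _).symm
        _ ≤ 5 * (r / 5) := by gcongr; norm_num
        _ = r := hr5r
    · rw [← hr5r]
      exact (hNd _ (huT i.2)).trans (by gcongr)
  · intro x hx
    by_cases hxF : ∃ i ∈ F, x ∈ (i : Set X)
    · obtain ⟨i, hi, hxi⟩ := hxF
      exact Set.mem_iUnion.2 ⟨i, by simpa [hi] using hxi⟩
    · push Not at hxF
      have hcl : IsClosed (⋃ i ∈ F, (i : Set X)) :=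
        F.finite_toSet.isClosed_biUnion fun i _ => (huT i.2).1
      have hop : IsOpen (V ∩ (⋃ i ∈ F, (i : Set X))ᶜ) := hV.inter hcl.isOpen_compl
      have hxo : x ∈ V ∩ (⋃ i ∈ F, (i : Set X))ᶜ := by
        refine ⟨hZV hx, ?_⟩
        simpa using hxF
      obtain ⟨e, he, hball⟩ := EMetric.isOpen_iff.1 hop x hxo
      obtain ⟨S, hScl, hxS, hSd, hSm⟩ := hZ x hx (min e (r / 5)) (lt_min he hr5)
      have hSsub : S ⊆ V ∩ (⋃ i ∈ F, (i : Set X))ᶜ := by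
        intro y hy
        apply hball
        rw [Metric.mem_eball]
        exact (edist_le_ediam_of_mem hy hxS).trans_lt (hSd.trans_le (min_le_left _ _))
      have hST : S ∈ T := ⟨hScl, ⟨x, hxS, hx⟩, fun y hy => (hSsub hy).1,
        hSd.le.trans (min_le_right _ _), hSm⟩
      obtain ⟨b, hbu, ⟨y, hyS, hyb⟩, hdb⟩ := hcov S hST
      have hbF : (⟨b, hbu⟩ : u) ∉ F := by
        intro hb
        exact (hSsub hyS).2 (Set.mem_biUnion hb hyb)
      refine Set.mem_iUnion.2 ⟨⟨b, hbu⟩, ?_⟩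
      simp only [hbF, if_false, hN]
      refine Set.mem_biUnion hyb ?_
      rw [mem_closedBall]
      refine le_trans ?_ hdb
      rw [dist_edist]
      exact ENNReal.toReal_mono (hfin S hST) (edist_le_ediam_of_mem hxS hyS)
  · have hle : ∀ i : u, ediam (if i ∈ F then (i : Set X) else N i) ^ α ≤
        ediam (i : Set X) ^ α +
          Set.indicator {x : u | x ∉ F} (fun i : u => 5 ^ α * ediam (i : Set X) ^ α) i := by
      intro i
      by_cases hi : i ∈ F
      · simp [hi]
      · simp only [hi, if_false, Set.indicator, Set.mem_ofPred_eq, not_false_eq_true, if_true]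
        refine le_trans ?_ le_add_self
        rw [← ENNReal.mul_rpow_of_nonneg _ _ hα.le]
        exact ENNReal.rpow_le_rpow (hNd _ (huT i.2)) hα.le
    refine (ENNReal.tsum_le_tsum hle).trans ?_
    rw [ENNReal.tsum_add, ← tsum_subtype, ENNReal.tsum_mul_left]
    exact add_le_add hsum hF.le

theorem hd_upper_null {X : Type*} [MetricSpace X] [MeasurableSpace X] [BorelSpace X]
    {α : ℝ} (hα : 0 < α) {E : Set X} (hE : MeasurableSet E) (hEf : μH[α] E ≠ ⊤)
    {lam : ℝ≥0∞} (hl : 1 < lam) (hl' : lam ≠ ⊤) {Z : Set X} (hZE : Z ⊆ E)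
    (hZ : ∀ x ∈ Z, ∀ r : ℝ≥0∞, 0 < r → ∃ S, IsClosed S ∧ x ∈ S ∧ ediam S < r ∧
      lam * ediam S ^ α < (μH[α] : Measure X).restrict E S) : μH[α] Z = 0 := by
  set μ := (μH[α] : Measure X).restrict E with hμ
  have : IsFiniteMeasure μ := isFiniteMeasure_restrict.2 hEf
  have hμZ : μ Z = μH[α] Z := by
    rw [hμ, Measure.restrict_apply' hE, Set.inter_eq_self_of_subset_left hZE]
  have hZf : μH[α] Z ≠ ⊤ := ne_top_of_le_ne_top hEf (measure_mono hZE)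
  have key : ∀ ζ : ℝ≥0∞, 0 < ζ → μH[α] Z ≤ lam⁻¹ * (μ Z + ζ) := by
    intro ζ hζ
    obtain ⟨V, hZV, hV, hVm⟩ := Z.exists_isOpen_le_add μ hζ.ne'
    have h1 : ∀ n : ℕ, ∃ (u : Set (Set X)) (t : u → Set X), u.Countable ∧
        (∀ i, ediam (t i) ≤ ((n : ℝ≥0∞) + 1)⁻¹) ∧ Z ⊆ ⋃ i, t i ∧
        ∑' i, ediam (t i) ^ α ≤ lam⁻¹ * μ V + ((n : ℝ≥0∞) + 1)⁻¹ := fun n =>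
      hd_cover hα μ hl hl' hV hZV hZ _ (by simp) (by simp) _ (by simp)
    choose u t hu hd hc hs using h1
    have : ∀ n, Countable (u n) := fun n => (hu n).to_subtype
    have hlim : Tendsto (fun n : ℕ => ((n : ℝ≥0∞) + 1)⁻¹) atTop (𝓝 0) := by
      have := ENNReal.tendsto_inv_nat_nhds_zero.comp (tendsto_add_atTop_nat 1)
      simpa [Function.comp_def] using this
    refine (Measure.hausdorffMeasure_le_liminf_tsum α Z _ hlim t (Eventually.of_forall hd)
      (Eventually.of_forall hc)).trans ?_
    have h2 : Tendsto (fun n : ℕ => lam⁻¹ * μ V + ((n : ℝ≥0∞) + 1)⁻¹) atTop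
        (𝓝 (lam⁻¹ * μ V + 0)) := hlim.const_add _
    rw [add_zero] at h2
    refine (liminf_le_liminf (Eventually.of_forall hs)).trans ?_
    rw [h2.liminf_eq]
    gcongr
  have key2 : μH[α] Z ≤ lam⁻¹ * μH[α] Z := by
    have h2 : Tendsto (fun n : ℕ => lam⁻¹ * (μ Z + (n : ℝ≥0∞)⁻¹)) atTop
        (𝓝 (lam⁻¹ * (μ Z + 0))) := by
      refine ENNReal.Tendsto.const_mul (ENNReal.tendsto_inv_nat_nhds_zero.const_add _)
        (Or.inr (ENNReal.inv_ne_top.2 (zero_lt_one.trans hl).ne'))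
    rw [add_zero, hμZ] at h2
    refine ge_of_tendsto' h2 fun n => ?_
    have h3 := key (n : ℝ≥0∞)⁻¹ (ENNReal.inv_pos.2 (ENNReal.natCast_ne_top n))
    rwa [hμZ] at h3
  by_contra hne
  have : lam⁻¹ * μH[α] Z < 1 * μH[α] Z := by
    rw [ENNReal.mul_lt_mul_iff_left hne hZf]
    exact ENNReal.inv_lt_one.2 hl
  rw [one_mul] at this
  exact absurd key2 this.not_ge

/-- Vitali-type bound. -/
theorem hd_ball_bound {X : Type*} [MetricSpace X] [MeasurableSpace X] [BorelSpace X]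
    [SecondCountableTopology X]
    {α : ℝ} (hα : 0 < α) (ρ : Measure X) [IsFiniteMeasure ρ] {c : ℝ≥0∞} (hc : c ≠ 0) (hc' : c ≠ ⊤)
    {Z V : Set X} (hV : IsOpen V) (hZV : Z ⊆ V)
    (hZ : ∀ x ∈ Z, ∀ R : ℝ, 0 < R → ∃ r, 0 < r ∧ r < R ∧
      c * ENNReal.ofReal r ^ α ≤ ρ (closedBall x r)) :
    μH[α] Z ≤ 10 ^ α * (c⁻¹ * ρ V) := by
  have h1 : ∀ n : ℕ, ∃ (u : Set (X × ℝ)) (t : u → Set X), u.Countable ∧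
      (∀ i, ediam (t i) ≤ 10 * ((n : ℝ≥0∞) + 1)⁻¹) ∧ Z ⊆ ⋃ i, t i ∧
      ∑' i, ediam (t i) ^ α ≤ 10 ^ α * (c⁻¹ * ρ V) := by
    intro n
    set T : Set (X × ℝ) := {a | 0 < a.2 ∧ a.2 < ((n : ℝ) + 1)⁻¹ ∧ closedBall a.1 a.2 ⊆ V ∧
      c * ENNReal.ofReal a.2 ^ α ≤ ρ (closedBall a.1 a.2)} with hT
    obtain ⟨u, huT, hdisj, hcov⟩ := Vitali.exists_disjoint_subfamily_covering_enlargement_closedBall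
      T (fun a => a.1) (fun a => a.2) ((n : ℝ) + 1)⁻¹ (fun a ha => ha.2.1.le) 5 (by norm_num)
    have hucount : u.Countable := by
      refine hdisj.countable_of_nonempty_interior fun a ha => ?_
      exact ⟨a.1, ball_subset_interior_closedBall (mem_ball_self (huT ha).1)⟩
    have : Countable u := hucount.to_subtype
    have hed : ∀ i : u, ediam (closedBall (i : X × ℝ).1 (5 * (i : X × ℝ).2)) ≤
        10 * ENNReal.ofReal (i : X × ℝ).2 := by
      intro i
      rw [← closedEBall_ofReal (by have := (huT i.2).1; positivity)]
      refine ediam_closedEBall_le.trans ?_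
      rw [← ENNReal.ofReal_ofNat 10, ← ENNReal.ofReal_mul (by norm_num), ← ENNReal.ofReal_ofNat 2,
        ← ENNReal.ofReal_mul (by norm_num)]
      exact ENNReal.ofReal_le_ofReal (by linarith)
    refine ⟨u, fun i => closedBall (i : X × ℝ).1 (5 * (i : X × ℝ).2), hucount, ?_, ?_, ?_⟩
    · intro i
      refine (hed i).trans ?_
      gcongr
      have := (huT i.2).2.1
      calc ENNReal.ofReal (i : X × ℝ).2 ≤ ENNReal.ofReal ((n : ℝ) + 1)⁻¹ :=
            ENNReal.ofReal_le_ofReal this.le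
        _ = ((n : ℝ≥0∞) + 1)⁻¹ := by
            rw [ENNReal.ofReal_inv_of_pos (by positivity), ENNReal.ofReal_add (by positivity)
              (by norm_num)]
            simp
    · intro x hx
      obtain ⟨e, he, hball⟩ := Metric.isOpen_iff.1 hV x (hZV hx)
      obtain ⟨r, hr, hrR, hrm⟩ := hZ x hx (min e ((n : ℝ) + 1)⁻¹) (lt_min he (by positivity))
      have : ((x, r) : X × ℝ) ∈ T := ⟨hr, hrR.trans_le (min_le_right _ _),
        (closedBall_subset_ball (hrR.trans_le (min_le_left _ _))).trans hball, hrm⟩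
      obtain ⟨b, hb, hsub⟩ := hcov _ this
      exact Set.mem_iUnion.2 ⟨⟨b, hb⟩, hsub (mem_closedBall_self hr.le)⟩
    · calc ∑' i : u, ediam (closedBall (i : X × ℝ).1 (5 * (i : X × ℝ).2)) ^ α
          ≤ ∑' i : u, 10 ^ α * (c⁻¹ * ρ (closedBall (i : X × ℝ).1 (i : X × ℝ).2)) := by
            refine ENNReal.tsum_le_tsum fun i => ?_
            refine (ENNReal.rpow_le_rpow (hed i) hα.le).trans ?_
            rw [ENNReal.mul_rpow_of_nonneg _ _ hα.le]
            gcongr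
            rw [mul_comm, ← div_eq_mul_inv, ENNReal.le_div_iff_mul_le (Or.inl hc) (Or.inl hc'),
              mul_comm]
            exact (huT i.2).2.2.2
        _ = 10 ^ α * (c⁻¹ * ρ (⋃ i : u, closedBall (i : X × ℝ).1 (i : X × ℝ).2)) := by
            rw [ENNReal.tsum_mul_left, ENNReal.tsum_mul_left, measure_iUnion]
            · intro i j hij
              exact hdisj i.2 j.2 (fun h => hij (Subtype.ext h))
            · exact fun i => isClosed_closedBall.measurableSet
        _ ≤ _ := by
            gcongr
            exact Set.iUnion_subset fun i => (huT i.2).2.2.1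
  choose u t hu hd hcv hs using h1
  have : ∀ n, Countable (u n) := fun n => (hu n).to_subtype
  have hlim : Tendsto (fun n : ℕ => 10 * ((n : ℝ≥0∞) + 1)⁻¹) atTop (𝓝 0) := by
    have := ENNReal.tendsto_inv_nat_nhds_zero.comp (tendsto_add_atTop_nat 1)
    have := ENNReal.Tendsto.const_mul (a := 10) this (Or.inr (by norm_num))
    simpa [Function.comp_def] using this
  refine (Measure.hausdorffMeasure_le_liminf_tsum α Z _ hlim t (Eventually.of_forall hd)
      (Eventually.of_forall hcv)).trans ?_
  refine (liminf_le_liminf (Eventually.of_forall hs)).trans ?_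
  simp

/-- Density theorem. -/
theorem hd_density {X : Type*} [MetricSpace X] [MeasurableSpace X] [BorelSpace X]
    [SecondCountableTopology X]
    {α : ℝ} (hα : 0 < α) (μ : Measure X) [IsFiniteMeasure μ] {c : ℝ≥0∞} (hc : c ≠ 0) (hc' : c ≠ ⊤)
    {A Z : Set X} (hA : MeasurableSet A) (hZA : Z ⊆ A)
    (hZ : ∀ x ∈ Z, ∀ R : ℝ, 0 < R → ∃ r, 0 < r ∧ r < R ∧
      c * ENNReal.ofReal r ^ α ≤ μ (closedBall x r \ A)) :
    μH[α] Z = 0 := by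
  have key : ∀ ζ : ℝ≥0∞, 0 < ζ → μH[α] Z ≤ 10 ^ α * (c⁻¹ * ζ) := by
    intro ζ hζ
    obtain ⟨V, hAV, hV, hVm⟩ := hA.exists_isOpen_sdiff_lt (measure_ne_top μ A) hζ.ne'
    have := hd_ball_bound hα (μ.restrict Aᶜ) hc hc' hV (hZA.trans hAV) (by
      intro x hx R hR
      obtain ⟨r, h1, h2, h3⟩ := hZ x hx R hR
      refine ⟨r, h1, h2, ?_⟩
      rwa [Measure.restrict_apply' hA.compl, ← Set.sdiff_eq])
    refine this.trans ?_
    gcongr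
    rw [Measure.restrict_apply' hA.compl, ← Set.sdiff_eq]
    exact hVm.2.le
  have h2 : Tendsto (fun n : ℕ => 10 ^ α * (c⁻¹ * (n : ℝ≥0∞)⁻¹)) atTop (𝓝 (10 ^ α * (c⁻¹ * 0))) := by
    refine ENNReal.Tendsto.const_mul (ENNReal.Tendsto.const_mul ENNReal.tendsto_inv_nat_nhds_zero
      (Or.inr (ENNReal.inv_ne_top.2 hc))) (Or.inr ?_)
    exact ENNReal.rpow_ne_top_of_nonneg hα.le (by norm_num)
  rw [mul_zero, mul_zero] at h2
  exact le_antisymm (ge_of_tendsto' h2 fun n => key _ (by simp)) (zero_le)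

structure Unif {X : Type*} [MetricSpace X] [MeasurableSpace X] (μ : Measure X) (α δ r0 : ℝ)
    (A : Set X) (x0 : X) : Prop where
  compact : IsCompact A
  mem : x0 ∈ A
  pos : 0 < r0
  lower : ∀ x ∈ A, ∀ r, 0 < r → r < r0 → (1 - δ) * (2 * r) ^ α ≤ μ.real (closedBall x r)
  upper : ∀ (S : Set X) (D : ℝ), 0 ≤ D → D < r0 → (S ∩ A).Nonempty →
    (∀ x ∈ S, ∀ y ∈ S, dist x y ≤ D) → μ.real S ≤ (1 + δ) * D ^ α
  dens : ∀ r, 0 < r → r < r0 → μ.real (closedBall x0 r \ A) ≤ δ * r ^ α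

theorem up_closed {X : Type*} [MetricSpace X] [MeasurableSpace X] {α : ℝ} (hα : 0 < α)
    (μ : Measure X) (c s : ℝ≥0∞) (hc : c ≠ ⊤) :
    IsClosed {x : X | ∀ S : Set X, x ∈ S → ediam S < s → μ S ≤ c * ediam S ^ α} := by
  rw [← isSeqClosed_iff_isClosed]
  intro xs x hxs hx S hxS hS
  have hd : ∀ k, ediam (insert (xs k) S) ≤ ediam S + edist (xs k) x := by
    intro k
    refine ediam_le fun a ha b hb => ?_
    rcases ha with rfl | ha <;> rcases hb with rfl | hb
    · simp
    · calc edist (xs k) b ≤ edist (xs k) x + edist x b := edist_triangle _ _ _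
        _ ≤ edist (xs k) x + ediam S := by gcongr; exact edist_le_ediam_of_mem hxS hb
        _ = _ := add_comm _ _
    · calc edist a (xs k) ≤ edist a x + edist x (xs k) := edist_triangle _ _ _
        _ ≤ ediam S + edist x (xs k) := by gcongr; exact edist_le_ediam_of_mem ha hxS
        _ = _ := by rw [edist_comm x]
    · exact (edist_le_ediam_of_mem ha hb).trans le_self_add
  have h0 : Tendsto (fun k => edist (xs k) x) atTop (𝓝 0) := by
    rw [← edist_self x]
    exact hx.edist tendsto_const_nhds
  have h1 : Tendsto (fun k => ediam S + edist (xs k) x) atTop (𝓝 (ediam S)) := by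
    simpa using h0.const_add (ediam S)
  have h2 : Tendsto (fun k => c * (ediam S + edist (xs k) x) ^ α) atTop (𝓝 (c * ediam S ^ α)) :=
    ENNReal.Tendsto.const_mul ((ENNReal.continuous_rpow_const.tendsto _).comp h1) (Or.inr hc)
  refine ge_of_tendsto h2 ?_
  filter_upwards [h1.eventually (gt_mem_nhds hS)] with k hk
  refine (measure_mono (Set.subset_insert (xs k) S)).trans ?_
  refine (hxs k _ (Set.mem_insert _ _) ((hd k).trans_lt hk)).trans ?_
  gcongr
  exact hd k

theorem lo_closed {X : Type*} [MetricSpace X] [MeasurableSpace X] [BorelSpace X]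
    (μ : Measure X) [IsFiniteMeasure μ] (c : ℝ → ℝ≥0∞) (s : ℝ) :
    IsClosed {x : X | ∀ r, 0 < r → r < s → c r ≤ μ (closedBall x r)} := by
  rw [← isSeqClosed_iff_isClosed]
  intro xs x hxs hx r hr hrs
  have h1 : Tendsto (fun n : ℕ => μ (closedBall x (r + 1 / ((n : ℝ) + 1)))) atTop
      (𝓝 (μ (⋂ n : ℕ, closedBall x (r + 1 / ((n : ℝ) + 1))))) := by
    refine tendsto_measure_iInter_atTop (fun n => isClosed_closedBall.measurableSet.nullMeasurableSet)
      ?_ ⟨0, measure_ne_top _ _⟩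
    intro m n hmn
    apply closedBall_subset_closedBall
    have := Nat.one_div_le_one_div (α := ℝ) hmn
    linarith
  have h2 : (⋂ n : ℕ, closedBall x (r + 1 / ((n : ℝ) + 1))) = closedBall x r := by
    ext y
    simp only [Set.mem_iInter, mem_closedBall]
    constructor
    · intro h
      have ht : Tendsto (fun n : ℕ => r + 1 / ((n : ℝ) + 1)) atTop (𝓝 (r + 0)) :=
        tendsto_one_div_add_atTop_nhds_zero_nat.const_add r
      rw [add_zero] at ht
      exact ge_of_tendsto' ht h
    · intro h n
      have : 0 < 1 / ((n : ℝ) + 1) := by positivity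
      linarith
  rw [h2] at h1
  refine ge_of_tendsto' h1 fun n => ?_
  have hpos : (0 : ℝ) < 1 / ((n : ℝ) + 1) := by positivity
  obtain ⟨k, hk⟩ := ((tendsto_iff_dist_tendsto_zero.1 hx).eventually (gt_mem_nhds hpos)).exists
  refine (hxs k r hr hrs).trans (measure_mono ?_)
  apply closedBall_subset_closedBall'
  linarith

theorem core_unif {X : Type*} [MetricSpace X] [ProperSpace X] [MeasurableSpace X] [BorelSpace X]
    {α : ℝ} (hα : 0 < α) {E : Set X} (hE : MeasurableSet E) (hEf : μH[α] E ≠ ⊤)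
    (hdens : ∀ᵐ x ∂((μH[α] : Measure X).restrict E), Tendsto
      (fun r : ℝ => μH[α] (E ∩ closedBall x r) / ENNReal.ofReal (2 * r) ^ α) (𝓝[>] 0) (𝓝 1))
    {E' : Set X} (hE'E : E' ⊆ E) (hE' : MeasurableSet E') (hpos : μH[α] E' ≠ 0)
    {δ : ℝ} (hδ : 0 < δ) (hδ1 : δ < 1) :
    ∃ A r0 x0, A ⊆ E' ∧ Unif ((μH[α] : Measure X).restrict E) α δ r0 A x0 := by
  set μ := (μH[α] : Measure X).restrict E with hμ
  have : IsFiniteMeasure μ := isFiniteMeasure_restrict.2 hEf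
  have hμs : ∀ S ⊆ E, μ S = μH[α] S := by
    intro S hS
    rw [hμ, Measure.restrict_apply' hE, Set.inter_eq_self_of_subset_left hS]
  set Up : ℕ → Set X := fun n => {x : X | ∀ S : Set X, x ∈ S → ediam S < ((n : ℝ≥0∞) + 1)⁻¹ →
    μ S ≤ ENNReal.ofReal (1 + δ) * ediam S ^ α} with hUp
  set Lo : ℕ → Set X := fun n => {x : X | ∀ r : ℝ, 0 < r → r < ((n : ℝ) + 1)⁻¹ →
    ENNReal.ofReal (1 - δ) * ENNReal.ofReal (2 * r) ^ α ≤ μ (closedBall x r)} with hLo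
  have hUpC : ∀ n, IsClosed (Up n) := fun n => up_closed hα μ _ _ ENNReal.ofReal_ne_top
  have hLoC : ∀ n, IsClosed (Lo n) := fun n => lo_closed μ
    (fun r => ENNReal.ofReal (1 - δ) * ENNReal.ofReal (2 * r) ^ α) _
  have hUpM : Monotone Up := by
    intro m n hmn x hx S hxS hS
    refine hx S hxS (hS.trans_le ?_)
    gcongr
  have hLoM : Monotone Lo := by
    intro m n hmn x hx r hr hrn
    refine hx r hr (hrn.trans_le ?_)
    gcongr
  have hUpae : ∀ᵐ x ∂μ, ∃ n, x ∈ Up n := by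
    rw [ae_iff, hμ, Measure.restrict_apply' hE]
    refine hd_upper_null hα hE hEf (lam := ENNReal.ofReal (1 + δ)) ?_ ENNReal.ofReal_ne_top
      Set.inter_subset_right ?_
    · rw [← ENNReal.ofReal_one]
      exact (ENNReal.ofReal_lt_ofReal_iff (by linarith)).2 (by linarith)
    · rintro x ⟨hx, -⟩ r hr
      simp only [not_exists, Set.mem_ofPred_eq] at hx
      obtain ⟨n, hn⟩ := ENNReal.exists_inv_nat_lt hr.ne'
      have := hx n
      simp only [hUp, Set.mem_ofPred_eq, not_forall, not_le] at this
      obtain ⟨S, hxS, hS, hSm⟩ := this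
      refine ⟨closure S, isClosed_closure, subset_closure hxS, ?_, ?_⟩
      · rw [ediam_closure]
        refine hS.trans (lt_of_le_of_lt ?_ hn)
        gcongr
        exact le_self_add
      · rw [ediam_closure]
        exact hSm.trans_le (measure_mono subset_closure)
  have hLoae : ∀ᵐ x ∂μ, ∃ n, x ∈ Lo n := by
    filter_upwards [hdens] with x hx
    have hlt : ENNReal.ofReal (1 - δ) < 1 := by
      rw [← ENNReal.ofReal_one]
      exact (ENNReal.ofReal_lt_ofReal_iff (by linarith)).2 (by linarith)
    have h1 := hx.eventually (lt_mem_nhds hlt)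
    rw [eventually_nhdsWithin_iff, Metric.eventually_nhds_iff] at h1
    obtain ⟨e, he, h1⟩ := h1
    obtain ⟨n, hn⟩ := exists_nat_one_div_lt he
    refine ⟨n, fun r hr hrn => ?_⟩
    have h2 := h1 (y := r) (by
      rw [Real.dist_eq, sub_zero, abs_of_pos hr]
      rw [one_div] at hn
      linarith) hr
    have h3 : ENNReal.ofReal (2 * r) ^ α ≠ 0 := by
      simp [ENNReal.rpow_eq_zero_iff, hα, hα.le.not_gt, hr]
    have h4 : ENNReal.ofReal (2 * r) ^ α ≠ ⊤ :=
      ENNReal.rpow_ne_top_of_nonneg hα.le ENNReal.ofReal_ne_top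
    rw [hμ, Measure.restrict_apply' hE, Set.inter_comm]
    exact (ENNReal.le_div_iff_mul_le (Or.inl h3) (Or.inl h4)).1 h2.le
  have hex : ∃ n, μ (E' ∩ (Up n ∩ Lo n)) ≠ 0 := by
    by_contra hcon
    push Not at hcon
    have h0 : μ (⋃ n, E' ∩ (Up n ∩ Lo n)) = 0 := measure_iUnion_null hcon
    apply hpos
    rw [← hμs E' hE'E]
    refine measure_mono_null_ae ?_ h0
    filter_upwards [hUpae, hLoae] with x ⟨n, hn⟩ ⟨m, hm⟩ hxE
    exact Set.mem_iUnion.2 ⟨max n m, hxE, hUpM (le_max_left _ _) hn, hLoM (le_max_right _ _) hm⟩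
  obtain ⟨n, hn⟩ := hex
  have hmeas : MeasurableSet (E' ∩ (Up n ∩ Lo n)) :=
    hE'.inter ((hUpC n).measurableSet.inter (hLoC n).measurableSet)
  obtain ⟨A, hAsub, hAc, hAm⟩ := hmeas.exists_lt_isCompact (pos_iff_ne_zero.2 hn)
  have hAE : A ⊆ E := fun x hx => hE'E (hAsub hx).1
  have hδ0 : ENNReal.ofReal δ ≠ 0 := by simpa using hδ
  have hZ0 := hd_density hα μ hδ0 ENNReal.ofReal_ne_top
    (A := A) (Z := {x ∈ A | ∀ R : ℝ, 0 < R → ∃ r, 0 < r ∧ r < R ∧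
      ENNReal.ofReal δ * ENNReal.ofReal r ^ α ≤ μ (closedBall x r \ A)}) hAc.measurableSet
    (fun x hx => hx.1) (fun x hx => hx.2)
  obtain ⟨x0, hx0A, hx0⟩ : ∃ x0 ∈ A, ∃ R : ℝ, 0 < R ∧ ∀ r, 0 < r → r < R →
      μ (closedBall x0 r \ A) ≤ ENNReal.ofReal δ * ENNReal.ofReal r ^ α := by
    by_contra hcon
    push Not at hcon
    rw [hμs A hAE] at hAm
    refine hAm.ne' (measure_mono_null ?_ hZ0)
    intro x hx
    refine ⟨hx, fun R hR => ?_⟩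
    obtain ⟨r, h1, h2, h3⟩ := hcon x hx R hR
    exact ⟨r, h1, h2, h3.le⟩
  obtain ⟨R, hR, hx0⟩ := hx0
  have hr0 : (0 : ℝ) < ((n : ℝ) + 1)⁻¹ := by positivity
  refine ⟨A, min R ((n : ℝ) + 1)⁻¹, x0, fun x hx => (hAsub hx).1, hAc, hx0A, lt_min hR hr0, ?_, ?_, ?_⟩
  · intro x hx r hr hrr
    have := (hAsub hx).2.2 r hr (hrr.trans_le (min_le_right _ _))
    rw [ENNReal.ofReal_rpow_of_nonneg (by positivity) hα.le,
      ← ENNReal.ofReal_mul (by linarith)] at this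
    exact (ENNReal.ofReal_le_iff_le_toReal (measure_ne_top _ _)).1 this
  · intro S D hD hDr ⟨x, hxS, hxA⟩ hS
    have hed : ediam S ≤ ENNReal.ofReal D := ediam_le fun a ha b hb => by
      rw [edist_dist]
      exact ENNReal.ofReal_le_ofReal (hS a ha b hb)
    have h1 : ENNReal.ofReal D < ((n : ℝ≥0∞) + 1)⁻¹ := by
      have : ((n : ℝ≥0∞) + 1)⁻¹ = ENNReal.ofReal ((n : ℝ) + 1)⁻¹ := by
        rw [ENNReal.ofReal_inv_of_pos (by positivity), ENNReal.ofReal_add (by positivity)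
              (by norm_num)]
        simp
      rw [this]
      exact (ENNReal.ofReal_lt_ofReal_iff hr0).2 (hDr.trans_le (min_le_right _ _))
    have h2 := (hAsub hxA).2.1 S hxS (hed.trans_lt h1)
    have h3 : μ S ≤ ENNReal.ofReal (1 + δ) * ENNReal.ofReal D ^ α := h2.trans (by gcongr)
    rw [ENNReal.ofReal_rpow_of_nonneg hD hα.le,
      ← ENNReal.ofReal_mul (by linarith)] at h3
    exact ENNReal.toReal_le_of_le_ofReal (by positivity) h3
  · intro r hr hrr
    have := hx0 r hr (hrr.trans_le (min_le_left _ _))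
    rw [ENNReal.ofReal_rpow_of_nonneg hr.le hα.le,
      ← ENNReal.ofReal_mul (by linarith)] at this
    exact ENNReal.toReal_le_of_le_ofReal (by positivity) this

section
variable {X : Type*} [MetricSpace X] [MeasurableSpace X] [BorelSpace X]
  {μ : Measure X} [IsFiniteMeasure μ] {α δ r0 : ℝ} {A : Set X} {x0 : X}

/-- mass of `A` in balls around `x0`. -/
theorem Unif.mass (hU : Unif μ α δ r0 A x0) {r : ℝ} (hr : 0 < r) (hr0 : r < r0) :
    (1 - δ) * (2 * r) ^ α - δ * r ^ α ≤ μ.real (closedBall x0 r ∩ A) := by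
  have h1 := hU.lower x0 hU.mem r hr hr0
  have h2 := hU.dens r hr hr0
  have h3 := measureReal_inter_add_sdiff (μ := μ) (s := closedBall x0 r) hU.compact.measurableSet
  linarith

theorem Unif.exists_near (hU : Unif μ α δ r0 A x0) (hα : 0 < α) (hδ : 0 ≤ δ)
    (hδ1 : δ < 1 / 3) {r : ℝ} (hr : 0 < r) :
    ∃ y ∈ A, y ≠ x0 ∧ dist x0 y ≤ r := by
  by_contra hcon
  push Not at hcon
  set s := min r (r0 / 2) with hs
  have hspos : 0 < s := lt_min hr (half_pos hU.pos)
  have hsr : s < r0 := (min_le_right _ _).trans_lt (half_lt_self hU.pos)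
  have h1 := hU.mass hspos hsr
  have h2 : closedBall x0 s ∩ A ⊆ {x0} := by
    rintro y ⟨hy, hyA⟩
    by_contra hne
    have := hcon y hyA hne
    rw [mem_closedBall, dist_comm] at hy
    exact absurd (hy.trans (min_le_left _ _)) this.not_ge
  have h3 : μ.real ({x0} : Set X) ≤ (1 + δ) * 0 ^ α := by
    refine hU.upper {x0} 0 le_rfl hU.pos ⟨x0, rfl, hU.mem⟩ ?_
    rintro x rfl y rfl
    simp
  rw [Real.zero_rpow hα.ne', mul_zero] at h3
  have h4 := measureReal_mono (μ := μ) h2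
  have h5 : s ^ α ≤ (2 * s) ^ α := Real.rpow_le_rpow hspos.le (by linarith) hα.le
  have h6 : 0 < s ^ α := Real.rpow_pos_of_pos hspos _
  nlinarith

/-- α ≥ 1. -/
theorem Unif.one_le (hU : Unif μ α δ r0 A x0) (hα : 0 < α) (hδ : 0 ≤ δ) (hδ1 : δ < 1 / 3) :
    2 * (1 - δ) ≤ (1 + δ) * 2 ^ α := by
  obtain ⟨y, hyA, hyx, hyr⟩ := hU.exists_near hα hδ hδ1 (r := r0 / 4) (by linarith [hU.pos])
  set D := dist x0 y with hD
  have hDpos : 0 < D := dist_pos.2 hyx.symm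
  have key : ∀ s : ℝ, s < D → 0 < s → 2 * ((1 - δ) * s ^ α) ≤ (1 + δ) * (2 * D) ^ α := by
    intro s hs hs0
    have h1 := hU.lower x0 hU.mem (s / 2) (by linarith) (by linarith)
    have h2 := hU.lower y hyA (s / 2) (by linarith) (by linarith)
    rw [mul_div_cancel₀ s two_ne_zero] at h1 h2
    have hdisj : Disjoint (closedBall x0 (s / 2)) (closedBall y (s / 2)) :=
      closedBall_disjoint_closedBall (by linarith)
    have h3 := measureReal_union (μ := μ) hdisj isClosed_closedBall.measurableSet
    have h4 : μ.real (closedBall x0 (s / 2) ∪ closedBall y (s / 2)) ≤ (1 + δ) * (2 * D) ^ α := by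
      refine hU.upper _ (2 * D) (by linarith) (by linarith [hU.pos])
        ⟨x0, Or.inl (mem_closedBall_self (by linarith)), hU.mem⟩ ?_
      rintro a (ha | ha) b (hb | hb) <;> rw [mem_closedBall] at ha hb
      · linarith [dist_triangle_right a b x0]
      · linarith [dist_triangle4 a x0 y b, dist_comm y b]
      · linarith [dist_triangle4 a y x0 b, dist_comm x0 b, dist_comm y x0]
      · linarith [dist_triangle_right a b y]
    linarith
  have hcont : Tendsto (fun s : ℝ => 2 * ((1 - δ) * s ^ α)) (𝓝[<] D) (𝓝 (2 * ((1 - δ) * D ^ α))) := by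
    have : ContinuousAt (fun s : ℝ => s ^ α) D :=
      Real.continuousAt_rpow_const _ _ (Or.inl hDpos.ne')
    exact ((this.tendsto.const_mul (1 - δ)).const_mul 2).mono_left nhdsWithin_le_nhds
  have h5 : 2 * ((1 - δ) * D ^ α) ≤ (1 + δ) * (2 * D) ^ α := by
    refine le_of_tendsto hcont ?_
    filter_upwards [self_mem_nhdsWithin, mem_nhdsWithin_of_mem_nhds (lt_mem_nhds hDpos)] with s h1 h2
    exact key s h1 h2
  rw [Real.mul_rpow (by norm_num) hDpos.le] at h5
  have h6 : 0 < D ^ α := Real.rpow_pos_of_pos hDpos _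
  by_contra hcon
  push Not at hcon
  nlinarith

end

section
variable {X : Type*} [MetricSpace X] [MeasurableSpace X] [BorelSpace X]
  {μ : Measure X} [IsFiniteMeasure μ] {δ r0 : ℝ} {A : Set X} {z : X}

theorem Unif.gap_point (hU : Unif μ 1 δ r0 A z) (hδ0 : 0 ≤ δ) (hδ : δ ≤ 1 / 10 ^ 8)
    {y : X} (hy : y ∈ A)
    {D : ℝ} (hD : D = dist z y) (hD0 : 0 < D) (hDr : 10 * D < r0) {t : ℝ} (ht0 : 0 ≤ t)
    (htD : t ≤ D) :
    (∃ w ∈ A, dist z w = t ∧ dist z w + dist w y ≤ (1 + 1 / 200) * D) ∨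
    ∃ p ∈ A, ∃ d, 0 < d ∧ d ≤ D ∧ |t - dist z p| ≤ d ∧ dist z p ≤ 2 * D ∧
      1 / 1000 * d ≤ μ.real (closedBall p d \ A) := by
  set K : Set (X × X) := (A ×ˢ A) ∩ {a | dist z a.1 ≤ t ∧ t ≤ dist z a.2} with hK
  have hKc : IsCompact K := by
    refine (hU.compact.prod hU.compact).inter_right ?_
    have c1 : IsClosed {a : X × X | dist z a.1 ≤ t} := isClosed_le (by fun_prop) (by fun_prop)
    have c2 : IsClosed {a : X × X | t ≤ dist z a.2} := isClosed_le (by fun_prop) (by fun_prop)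
    exact c1.inter c2
  have hzy : (z, y) ∈ K := ⟨⟨hU.mem, hy⟩, by simpa using ht0, by simpa [← hD] using htD⟩
  obtain ⟨⟨p, q⟩, hpq, hmin⟩ := hKc.exists_isMinOn ⟨_, hzy⟩
    (f := fun a : X × X => dist z a.1 + (1 + 1 / 200) * dist a.1 a.2 + dist a.2 y)
    (by fun_prop)
  have hmin' : ∀ a b, a ∈ A → b ∈ A → dist z a ≤ t → t ≤ dist z b →
      dist z p + (1 + 1 / 200) * dist p q + dist q y ≤
        dist z a + (1 + 1 / 200) * dist a b + dist b y := by
    intro a b ha hb h1 h2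
    exact hmin (show (a, b) ∈ K from ⟨⟨ha, hb⟩, h1, h2⟩)
  obtain ⟨⟨hpA, hqA⟩, hpt, hqt⟩ := hpq
  simp only at hpA hqA hpt hqt
  have h0 := hmin' z y hU.mem hy (by simpa using ht0) (by simpa [← hD] using htD)
  rw [dist_self, dist_self, ← hD] at h0
  have hzp : 0 ≤ dist z p := dist_nonneg
  have hqy : 0 ≤ dist q y := dist_nonneg
  set d := dist p q with hd
  have hdnn : 0 ≤ d := dist_nonneg
  have hdD : d ≤ D := by nlinarith
  have hzq : dist z q ≤ dist z p + d := dist_triangle _ _ _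
  rcases hdnn.eq_or_lt with hd0 | hd0
  · left
    have hpq : p = q := dist_eq_zero.1 hd0.symm
    refine ⟨p, hpA, le_antisymm hpt (hpq ▸ hqt), ?_⟩
    rw [← hpq, ← hd0] at h0
    linarith
  · right
    refine ⟨p, hpA, d, hd0, hdD, ?_, by nlinarith, ?_⟩
    · rw [abs_le]; constructor <;> linarith
    set s := (1 / 2 + 1 / 1000) * d with hs
    have h1 := hU.lower p hpA s (by positivity) (by rw [hs]; linarith)
    have h2 := hU.lower q hqA s (by positivity) (by rw [hs]; linarith)
    rw [Real.rpow_one] at h1 h2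
    have h3 : μ.real (closedBall p s ∪ closedBall q s) ≤ (1 + δ) * (d + 2 * s) ^ (1 : ℝ) := by
      refine hU.upper _ _ (by positivity) (by rw [hs]; linarith)
        ⟨p, Or.inl (mem_closedBall_self (by positivity)), hpA⟩ ?_
      rintro a (ha | ha) b (hb | hb) <;> rw [mem_closedBall] at ha hb
      · linarith [dist_triangle_right a b p]
      · linarith [dist_triangle4 a p q b, dist_comm q b]
      · linarith [dist_triangle4 a q p b, dist_comm p b, dist_comm q p]
      · linarith [dist_triangle_right a b q]
    rw [Real.rpow_one] at h3
    have h4 := measureReal_union_add_inter (μ := μ) (s := closedBall p s) (t := closedBall q s)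
      isClosed_closedBall.measurableSet
    have h5 : 1 / 1000 * d ≤ μ.real (closedBall p s ∩ closedBall q s) := by
      have : (1 - δ) * (2 * s) + (1 - δ) * (2 * s) - (1 + δ) * (d + 2 * s) =
        2 / 1000 * d - δ * (6 * s + d) := by rw [hs]; ring
      have h6 : δ * (6 * s + d) ≤ 1 / 1000 * d := by
        rw [hs]; nlinarith
      linarith
    refine h5.trans (measureReal_mono ?_)
    rintro m ⟨hmp, hmq⟩
    rw [mem_closedBall] at hmp hmq
    refine ⟨?_, fun hmA => ?_⟩
    · rw [mem_closedBall]; rw [hs] at hmp; linarith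
    · rcases le_total (dist z m) t with hmt | hmt
      · have := hmin' m q hmA hqA hmt hqt
        have h7 := dist_triangle_right z m p
        have h8 : dist z m ≤ dist z p + s := by linarith [dist_triangle z p m, dist_comm p m]
        rw [hs] at *
        linarith
      · have := hmin' p m hpA hmA hpt hmt
        have h8 : dist m y ≤ dist q y + s := by linarith [dist_triangle m q y]
        rw [dist_comm] at hmp
        rw [hs] at *
        linarith

theorem Unif.gap_vol (hU : Unif μ 1 δ r0 A z) [SecondCountableTopology X]
    (hδ0 : 0 ≤ δ) (hδ : δ ≤ 1 / 10 ^ 8)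
    {y : X} (hy : y ∈ A)
    {D : ℝ} (hD : D = dist z y) (hD0 : 0 < D) (hDr : 10 * D < r0) :
    volume (Set.Icc 0 D \ (dist z '' {w ∈ A | dist z w + dist w y ≤ (1 + 1 / 200) * D})) ≤
      ENNReal.ofReal (1 / 1000 * D) := by
  set T := dist z '' {w ∈ A | dist z w + dist w y ≤ (1 + 1 / 200) * D} with hT
  have h : ∀ t : ℝ, ∃ (p : X) (d : ℝ), t ∈ Set.Icc 0 D \ T →
      (0 < d ∧ d ≤ D ∧ |t - dist z p| ≤ d ∧ dist z p ≤ 2 * D ∧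
      1 / 1000 * d ≤ μ.real (closedBall p d \ A)) := by
    intro t
    by_cases ht : t ∈ Set.Icc 0 D \ T
    · rcases hU.gap_point hδ0 hδ hy hD hD0 hDr ht.1.1 ht.1.2 with ⟨w, hw, hwt, hwD⟩ | ⟨p, -, d, h⟩
      · exact absurd ⟨w, ⟨hw, hwD⟩, hwt⟩ ht.2
      · exact ⟨p, d, fun _ => h⟩
    · exact ⟨z, 0, fun h => absurd h ht⟩
  choose p d h using h
  obtain ⟨u, huT, hdisj, hcov⟩ := Vitali.exists_disjoint_subfamily_covering_enlargement
    (fun t => closedBall (p t) (d t)) (Set.Icc 0 D \ T) d 2 one_lt_two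
    (fun t ht => (h t ht).1.le) D (fun t ht => (h t ht).2.1)
    (fun t ht => ⟨p t, mem_closedBall_self (h t ht).1.le⟩)
  have hucount : u.Countable := by
    refine hdisj.countable_of_nonempty_interior fun a ha => ?_
    exact ⟨p a, ball_subset_interior_closedBall (mem_ball_self (h a (huT ha)).1)⟩
  have : Countable u := hucount.to_subtype
  have hsub : Set.Icc 0 D \ T ⊆ ⋃ b : u, closedBall (dist z (p b)) (5 * d b) := by
    intro t ht
    obtain ⟨b, hb, ⟨x, hx1, hx2⟩, hdb⟩ := hcov t ht
    refine Set.mem_iUnion.2 ⟨⟨b, hb⟩, ?_⟩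
    rw [mem_closedBall] at *
    rw [Real.dist_eq]
    have h1 := (h t ht).2.2.1
    have h2 : |dist z (p t) - dist z (p b)| ≤ dist (p t) (p b) := by
      rw [dist_comm z, dist_comm z]; exact abs_dist_sub_le _ _ _
    have h3 := dist_triangle_left (p t) (p b) x
    rw [abs_le] at *
    constructor <;> linarith
  have hterm : ∀ b : u, volume (closedBall (dist z (p b)) (5 * d b)) ≤
      ENNReal.ofReal 10000 * μ (closedBall (p b) (d b) \ A) := by
    intro b
    obtain ⟨h1, h2, h3, h4, h5⟩ := h b (huT b.2)
    rw [Real.volume_closedBall, ← ofReal_measureReal, ← ENNReal.ofReal_mul (by norm_num)]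
    apply ENNReal.ofReal_le_ofReal
    linarith
  calc volume (Set.Icc 0 D \ T) ≤ volume (⋃ b : u, closedBall (dist z (p b)) (5 * d b)) :=
        measure_mono hsub
    _ ≤ ∑' b : u, volume (closedBall (dist z (p b)) (5 * d b)) := measure_iUnion_le _
    _ ≤ ∑' b : u, ENNReal.ofReal 10000 * μ (closedBall (p b) (d b) \ A) :=
        ENNReal.tsum_le_tsum hterm
    _ = ENNReal.ofReal 10000 * μ (⋃ b : u, closedBall (p b) (d b) \ A) := by
        rw [ENNReal.tsum_mul_left, measure_iUnion]
        · intro i j hij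
          exact (hdisj i.2 j.2 (fun h => hij (Subtype.ext h))).mono Set.sdiff_subset Set.sdiff_subset
        · exact fun i => isClosed_closedBall.measurableSet.diff hU.compact.measurableSet
    _ ≤ ENNReal.ofReal 10000 * μ (closedBall z (4 * D) \ A) := by
        gcongr
        refine Set.iUnion_subset fun b => ?_
        refine Set.sdiff_subset_sdiff_left ?_
        obtain ⟨h1, h2, h3, h4, h5⟩ := h b (huT b.2)
        apply closedBall_subset_closedBall'
        rw [dist_comm]; linarith
    _ ≤ ENNReal.ofReal 10000 * ENNReal.ofReal (δ * (4 * D)) := by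
        gcongr
        have := hU.dens (4 * D) (by linarith) (by linarith)
        rw [Real.rpow_one] at this
        rw [← ofReal_measureReal]
        exact ENNReal.ofReal_le_ofReal this
    _ ≤ _ := by
        rw [← ENNReal.ofReal_mul (by norm_num)]
        apply ENNReal.ofReal_le_ofReal
        nlinarith

/-- abstract one-dimensional covering lemma -/
theorem good_vol (ν : Measure ℝ) [IsFiniteMeasure ν] {T : Set ℝ} (hT : MeasurableSet T) {D M : ℝ}
    (hD0 : 0 < D)
    (hT1 : ENNReal.ofReal (999 / 1000 * D) ≤ volume T) (hTf : volume T ≠ ⊤)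
    (hν : ν Set.univ ≤ ENNReal.ofReal (1022 / 1000 * D))
    (hνT : ∀ J, MeasurableSet J → volume (T ∩ J) ≤ ν J) :
    volume (T \ {t | ∃ ρ, 0 < ρ ∧ ρ ≤ M ∧ ENNReal.ofReal (3 * ρ) < ν (closedBall t ρ)}) ≠ 0 := by
  set B := T ∩ {t | ∃ ρ, 0 < ρ ∧ ρ ≤ M ∧ ENNReal.ofReal (3 * ρ) < ν (closedBall t ρ)} with hB
  have h : ∀ t : ℝ, ∃ ρ, t ∈ B → 0 < ρ ∧ ρ ≤ M ∧ ENNReal.ofReal (3 * ρ) < ν (closedBall t ρ) := by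
    intro t
    by_cases ht : t ∈ B
    · obtain ⟨ρ, h⟩ := ht.2
      exact ⟨ρ, fun _ => h⟩
    · exact ⟨0, fun h => absurd h ht⟩
  choose ρ h using h
  obtain ⟨u, huT, hdisj, hcov⟩ := Vitali.exists_disjoint_subfamily_covering_enlargement_closedBall
      B (fun a => a) ρ M (fun a ha => (h a ha).2.1) 5 (by norm_num)
  have hucount : u.Countable := by
    refine hdisj.countable_of_nonempty_interior fun a ha => ?_
    exact ⟨a, ball_subset_interior_closedBall (mem_ball_self (h a (huT ha)).1)⟩
  have : Countable u := hucount.to_subtype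
  set J : Set ℝ := ⋃ b : u, closedBall (b : ℝ) (ρ b) with hJ
  have hdisj' : Pairwise (Function.onFun Disjoint (fun b : u => closedBall (b : ℝ) (ρ b))) :=
    fun i j hij => hdisj i.2 j.2 (fun h => hij (Subtype.ext h))
  have hJm : MeasurableSet J := MeasurableSet.iUnion fun b => isClosed_closedBall.measurableSet
  have hvJ : volume J = ∑' b : u, ENNReal.ofReal (2 * ρ b) := by
    rw [hJ, measure_iUnion hdisj' (fun b => isClosed_closedBall.measurableSet)]
    simp [Real.volume_closedBall]
  have hnJ : ENNReal.ofReal (3 / 2) * volume J ≤ ν J := by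
    rw [hvJ, hJ, measure_iUnion hdisj' (fun b => isClosed_closedBall.measurableSet),
      ← ENNReal.tsum_mul_left]
    refine ENNReal.tsum_le_tsum fun b => ?_
    rw [← ENNReal.ofReal_mul (by norm_num)]
    refine le_trans (le_of_eq ?_) (h b (huT b.2)).2.2.le
    congr 1; ring
  have hvB : volume B ≤ ENNReal.ofReal 5 * volume J := by
    have hsub : B ⊆ ⋃ b : u, closedBall (b : ℝ) (5 * ρ b) := by
      intro t ht
      obtain ⟨b, hb, hsub⟩ := hcov t ht
      exact Set.mem_iUnion.2 ⟨⟨b, hb⟩, hsub (mem_closedBall_self (h t ht).1.le)⟩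
    refine (measure_mono hsub).trans ((measure_iUnion_le _).trans ?_)
    rw [hvJ, ← ENNReal.tsum_mul_left]
    refine ENNReal.tsum_le_tsum fun b => ?_
    rw [← ENNReal.ofReal_mul (by norm_num), Real.volume_closedBall]
    apply le_of_eq; congr 1; ring
  have hTJ : volume T ≤ volume J + ν Jᶜ := by
    calc volume T = volume (T ∩ J) + volume (T \ J) := (measure_inter_add_sdiff T hJm).symm
      _ ≤ volume J + ν Jᶜ := by
        rw [Set.sdiff_eq]
        exact add_le_add (measure_mono Set.inter_subset_right) (hνT _ hJm.compl)
  have hνtot : ν J + ν Jᶜ = ν Set.univ := measure_add_measure_compl hJm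
  have hνJf : ν J ≠ ⊤ := measure_ne_top _ _
  have hvJf : volume J ≠ ⊤ := by
    intro htop
    rw [htop, ENNReal.mul_top (by simp)] at hnJ
    exact hνJf (top_le_iff.1 hnJ)
  intro hzero
  have hTB : volume T ≤ volume B + 0 := by
    rw [← hzero]
    calc volume T ≤ volume (B ∪ (T \ {t | ∃ ρ, 0 < ρ ∧ ρ ≤ M ∧
          ENNReal.ofReal (3 * ρ) < ν (closedBall t ρ)})) := by
          rw [hB, Set.inter_union_sdiff]
      _ ≤ _ := measure_union_le _ _
  rw [add_zero] at hTB
  have e1 : 999 / 1000 * D ≤ (volume T).toReal :=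
    (ENNReal.ofReal_le_iff_le_toReal hTf).1 hT1
  have e2 : (ν J).toReal + (ν Jᶜ).toReal ≤ 1022 / 1000 * D := by
    rw [← ENNReal.toReal_add hνJf (measure_ne_top _ _), hνtot]
    exact ENNReal.toReal_le_of_le_ofReal (by positivity) hν
  have e3 : (volume T).toReal ≤ (volume J).toReal + (ν Jᶜ).toReal := by
    rw [← ENNReal.toReal_add hvJf (measure_ne_top _ _)]
    exact ENNReal.toReal_mono (by finiteness) hTJ
  have e4 : 3 / 2 * (volume J).toReal ≤ (ν J).toReal := by
    have := ENNReal.toReal_mono hνJf hnJ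
    rwa [ENNReal.toReal_mul, ENNReal.toReal_ofReal (by norm_num)] at this
  have e5 : (volume T).toReal ≤ 5 * (volume J).toReal := by
    have := ENNReal.toReal_mono (by finiteness) (hTB.trans hvB)
    rwa [ENNReal.toReal_mul, ENNReal.toReal_ofReal (by norm_num)] at this
  linarith

theorem Unif.piece (hU : Unif μ 1 δ r0 A z) [SecondCountableTopology X]
    (hδ0 : 0 ≤ δ) (hδ : δ ≤ 1 / 10 ^ 8)
    (hvol : ∀ S ⊆ A, ∀ P : X → ℝ, LipschitzWith 1 P → volume (P '' S) ≤ μ S) :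
    ∃ C ⊆ A, IsCompact C ∧ μ C ≠ 0 ∧ ∀ a ∈ C, ∀ b ∈ C, dist a b ≤ 10 * |dist z a - dist z b| := by
  obtain ⟨y, hy, hyz, hyr⟩ := hU.exists_near one_pos hδ0 (by norm_num at hδ ⊢; linarith)
    (r := r0 / 20) (by linarith [hU.pos])
  obtain ⟨D, hD⟩ : ∃ D, D = dist z y := ⟨_, rfl⟩
  have hD0 : 0 < D := hD ▸ dist_pos.2 hyz.symm
  rw [← hD] at hyr
  have hDr : 10 * D < r0 := by linarith [hU.pos]
  have hgap := hU.gap_vol hδ0 hδ hy hD hD0 hDr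
  set S := {w ∈ A | dist z w + dist w y ≤ (1 + 1 / 200) * D} with hS
  have hcl0 : IsClosed {w : X | dist z w + dist w y ≤ (1 + 1 / 200) * D} :=
    isClosed_le (by fun_prop) (by fun_prop)
  have hSc : IsCompact S := hU.compact.inter_right hcl0
  have hP : LipschitzWith 1 (dist z) := LipschitzWith.dist_right z
  set T := Set.Icc 0 D ∩ dist z '' S with hT
  have hTc : IsCompact T := isCompact_Icc.inter (hSc.image hP.continuous)
  set W : Set X := {w | dist z w + dist w y ≤ (1 + 20 / 1000) * D} with hW
  have hWc : IsClosed W := isClosed_le (by fun_prop) (by fun_prop)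
  set ν := (μ.restrict W).map (dist z) with hν
  have hPm : Measurable (dist z) := hP.continuous.measurable
  have hνa : ∀ J, MeasurableSet J → ν J = μ (dist z ⁻¹' J ∩ W) := by
    intro J hJ
    rw [hν, Measure.map_apply hPm hJ, Measure.restrict_apply (hPm hJ)]
  have hfin : IsFiniteMeasure ν := by
    constructor
    rw [hνa _ MeasurableSet.univ]
    exact measure_lt_top _ _
  have hSW : S ⊆ W := by
    intro w hw
    have := hw.2
    simp only [hW, Set.mem_ofPred_eq]
    linarith
  have hgood := good_vol ν hTc.measurableSet (D := D) (M := D / 1000) hD0 (by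
      have h1 : volume (Set.Icc 0 D) ≤ volume T + volume (Set.Icc 0 D \ (dist z '' S)) := by
        rw [hT, measure_inter_add_sdiff _ (hSc.image hP.continuous).measurableSet]
      rw [Real.volume_Icc, sub_zero] at h1
      have h2 := h1.trans (add_le_add_right hgap _)
      have h3 := ENNReal.toReal_mono (by
        have := hTc.measure_lt_top (μ := volume)
        finiteness) h2
      rw [ENNReal.toReal_add hTc.measure_lt_top.ne (by finiteness),
        ENNReal.toReal_ofReal hD0.le, ENNReal.toReal_ofReal (by positivity)] at h3
      rw [ENNReal.ofReal_le_iff_le_toReal hTc.measure_lt_top.ne]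
      linarith) hTc.measure_lt_top.ne (by
      rw [hνa _ MeasurableSet.univ, Set.preimage_univ, Set.univ_inter, ← ofReal_measureReal]
      apply ENNReal.ofReal_le_ofReal
      have := hU.upper W ((1 + 20 / 1000) * D) (by positivity) (by linarith)
        ⟨z, by simp only [hW, Set.mem_ofPred_eq, dist_self, ← hD]; linarith, hU.mem⟩ (by
          intro a ha b hb
          simp only [hW, Set.mem_ofPred_eq] at ha hb
          have h1 := dist_triangle_left a b z
          have h2 := dist_triangle_right a b y
          linarith)
      rw [Real.rpow_one] at this
      nlinarith) (by
      intro J hJ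
      have h1 := hvol (S ∩ dist z ⁻¹' J) (fun w hw => hw.1.1) _ hP
      rw [hνa J hJ]
      refine le_trans (measure_mono ?_) (h1.trans (measure_mono ?_))
      · rintro t ⟨⟨-, w, hw, rfl⟩, htJ⟩
        exact ⟨w, ⟨hw, htJ⟩, rfl⟩
      · exact fun w hw => ⟨hw.2, hSW hw.1⟩)
  set Bad : Set ℝ := {t | ∃ ρ, 0 < ρ ∧ ρ ≤ D / 1000 ∧ ENNReal.ofReal (3 * ρ) < ν (closedBall t ρ)}
    with hBad
  set G := {w ∈ S | dist z w ∉ Bad} with hG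
  have hGA : G ⊆ A := fun w hw => hw.1.1
  have hGm : μ G ≠ 0 := by
    intro h0
    have h1 := hvol G hGA _ hP
    rw [h0] at h1
    refine hgood (le_antisymm (le_trans (measure_mono ?_) h1) zero_le)
    rintro t ⟨⟨-, w, hw, rfl⟩, htB⟩
    exact ⟨w, ⟨hw, htB⟩, rfl⟩
  have hanti : ∀ a ∈ G, ∀ b ∈ G, dist a b ≤ D / 1000 → dist a b ≤ 10 * |dist z a - dist z b| := by
    intro a ha b hb hab
    by_contra hcon
    push Not at hcon
    set d := dist a b with hd
    set h := |dist z a - dist z b| with hh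
    have hh0 : 0 ≤ h := abs_nonneg _
    have hd0 : 0 < d := by linarith
    have h1 := hU.lower a (hGA ha) (d / 3) (by linarith) (by linarith)
    have h2 := hU.lower b (hGA hb) (d / 3) (by linarith) (by linarith)
    rw [Real.rpow_one] at h1 h2
    have hdisj : Disjoint (closedBall a (d / 3)) (closedBall b (d / 3)) :=
      closedBall_disjoint_closedBall (by linarith)
    have h3 := measureReal_union (μ := μ) hdisj isClosed_closedBall.measurableSet
    have hnb : dist z a ∉ Bad := ha.2
    simp only [hBad, Set.mem_ofPred_eq, not_exists, not_and, not_lt] at hnb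
    have h4 := hnb (d / 3 + h) (by linarith) (by linarith)
    rw [hνa _ isClosed_closedBall.measurableSet] at h4
    have h5 : closedBall a (d / 3) ∪ closedBall b (d / 3) ⊆
        dist z ⁻¹' closedBall (dist z a) (d / 3 + h) ∩ W := by
      have haS := ha.1.2
      have hbS := hb.1.2
      have hPl : ∀ v w, |dist z v - dist z w| ≤ dist v w := by
        intro v w
        rw [dist_comm z, dist_comm z]; exact abs_dist_sub_le _ _ _
      rintro w (hw | hw) <;> rw [mem_closedBall] at hw
      · refine ⟨?_, ?_⟩
        · rw [Set.mem_preimage, mem_closedBall, Real.dist_eq]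
          linarith [hPl w a]
        · simp only [hW, Set.mem_ofPred_eq]
          linarith [dist_triangle z a w, dist_triangle w a y, dist_comm a w]
      · refine ⟨?_, ?_⟩
        · rw [Set.mem_preimage, mem_closedBall, Real.dist_eq]
          have := abs_sub_le (dist z w) (dist z b) (dist z a)
          rw [abs_sub_comm (dist z b)] at this
          linarith [hPl w b]
        · simp only [hW, Set.mem_ofPred_eq]
          linarith [dist_triangle z b w, dist_triangle w b y, dist_comm b w]
    have h6 := ENNReal.toReal_le_of_le_ofReal (by positivity) ((measure_mono h5).trans h4)
    change μ.real _ ≤ _ at h6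
    nlinarith
  obtain ⟨t, -, htf, htc⟩ := finite_cover_balls_of_compact hU.compact
    (half_pos (show 0 < D / 1000 by linarith))
  obtain ⟨c, hc⟩ : ∃ c, μ (G ∩ ball c (D / 1000 / 2)) ≠ 0 := by
    by_contra hcon
    push Not at hcon
    refine hGm (measure_mono_null ?_ ((measure_biUnion_null_iff htf.countable).2
      (fun c _ => hcon c)))
    intro w hw
    obtain ⟨c, hc, hwc⟩ := Set.mem_iUnion₂.1 (htc (hGA hw))
    exact Set.mem_iUnion₂.2 ⟨c, hc, hw, hwc⟩
  have hsub : closure (G ∩ ball c (D / 1000 / 2)) ⊆ A :=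
    closure_minimal (fun w hw => hGA hw.1) hU.compact.isClosed
  refine ⟨closure (G ∩ ball c (D / 1000 / 2)), hsub,
    hU.compact.of_isClosed_subset isClosed_closure hsub,
    fun h0 => hc (measure_mono_null subset_closure h0), ?_⟩
  have hcl : IsClosed {a : X × X | dist a.1 a.2 ≤ 10 * |dist z a.1 - dist z a.2|} :=
    isClosed_le (by fun_prop) (by fun_prop)
  have hsub2 : closure ((G ∩ ball c (D / 1000 / 2)) ×ˢ (G ∩ ball c (D / 1000 / 2))) ⊆
      {a : X × X | dist a.1 a.2 ≤ 10 * |dist z a.1 - dist z a.2|} := by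
    refine closure_minimal ?_ hcl
    rintro ⟨a, b⟩ ⟨⟨ha, hac⟩, ⟨hb, hbc⟩⟩
    rw [mem_ball] at hac hbc
    exact hanti a ha b hb (by linarith [dist_triangle_right a b c])
  intro a ha b hb
  have hab : (a, b) ∈ closure ((G ∩ ball c (D / 1000 / 2)) ×ˢ (G ∩ ball c (D / 1000 / 2))) := by
    rw [closure_prod_eq]; exact ⟨ha, hb⟩
  exact hsub2 hab

end

/-- the symplectic form on the plane, in complex form -/
def om (a b : ℂ) : ℝ := a.re * b.im - a.im * b.re

theorem om_eq (a b : ℂ) : om a b = ((starRingEnd ℂ) a * b).im := by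
  simp [om]; ring

theorem abs_om_le (a b : ℂ) : |om a b| ≤ ‖a‖ * ‖b‖ := by
  rw [om_eq]
  refine (Complex.abs_im_le_norm _).trans ?_
  rw [norm_mul, Complex.norm_conj]

/-- the smooth-box metric in complex form -/
def IsBox {X : Type*} [MetricSpace X] (h : X → ℂ) (v : X → ℝ) (ε : ℝ) : Prop :=
  ∀ p q : X, dist p q = max ‖h q - h p‖ (ε * √|v q - v p - 2 * om (h p) (h q)|)

section
variable {X : Type*} [MetricSpace X] {h : X → ℂ} {v : X → ℝ} {ε : ℝ}

theorem IsBox.norm_le (hB : IsBox h v ε) (p q : X) : ‖h q - h p‖ ≤ dist p q := by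
  rw [hB p q]; exact le_max_left _ _

theorem IsBox.vert_le (hB : IsBox h v ε) (hε : 0 < ε) (p q : X) :
    ε ^ 2 * |v q - v p - 2 * om (h p) (h q)| ≤ dist p q ^ 2 := by
  have h1 : ε * √|v q - v p - 2 * om (h p) (h q)| ≤ dist p q := by
    rw [hB p q]; exact le_max_right _ _
  have h2 := pow_le_pow_left₀ (by positivity) h1 2
  rwa [mul_pow, Real.sq_sqrt (abs_nonneg _)] at h2

theorem IsBox.horiz (hB : IsBox h v ε) (hε : 0 < ε) (hε2 : ε ≤ 1 / 2) {c w u : X} {d s : ℝ}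
    (hd : 0 < d) (hs : 20 * s ≤ d) (hcw : dist c w ≤ d) (hcu : dist c u ≤ d)
    (hwu : 2 * d - 5 * s < dist w u) : dist w u = ‖h u - h w‖ := by
  rw [hB w u]
  refine max_eq_left ?_
  by_contra hcon
  push Not at hcon
  have h0 : dist w u = ε * √|v u - v w - 2 * om (h w) (h u)| := by
    rw [hB w u]; exact max_eq_right hcon.le
  have h1 : dist w u ^ 2 = ε ^ 2 * |v u - v w - 2 * om (h w) (h u)| := by
    rw [h0, mul_pow, Real.sq_sqrt (abs_nonneg _)]
  have h2 := hB.vert_le hε w c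
  have h3 := hB.vert_le hε c u
  rw [dist_comm] at h2
  have h4 := abs_om_le (h c - h w) (h u - h c)
  have h5 := hB.norm_le c u
  have h6 := hB.norm_le w c
  rw [dist_comm] at h6
  have h7 : ‖h c - h w‖ * ‖h u - h c‖ ≤ d * d :=
    mul_le_mul (h6.trans hcw) (h5.trans hcu) (norm_nonneg _) hd.le
  have h8 : v u - v w - 2 * om (h w) (h u) = (v c - v w - 2 * om (h w) (h c)) +
      (v u - v c - 2 * om (h c) (h u)) + 2 * om (h c - h w) (h u - h c) := by
    simp only [om, Complex.sub_re, Complex.sub_im]; ring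
  have h9 : |v u - v w - 2 * om (h w) (h u)| ≤ |v c - v w - 2 * om (h w) (h c)| +
      |v u - v c - 2 * om (h c) (h u)| + 2 * (d * d) := by
    rw [h8]
    refine (abs_add_three _ _ _).trans ?_
    rw [abs_mul, abs_two]
    linarith
  have h10 : ε ^ 2 ≤ 1 / 4 := by nlinarith
  have h11 : dist c w ^ 2 ≤ d ^ 2 := pow_le_pow_left₀ dist_nonneg hcw 2
  have h12 : dist c u ^ 2 ≤ d ^ 2 := pow_le_pow_left₀ dist_nonneg hcu 2
  have h13 : (7 / 4 * d) ^ 2 ≤ dist w u ^ 2 := pow_le_pow_left₀ (by positivity) (by linarith) 2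
  have h14 := mul_le_mul_of_nonneg_left h9 (sq_nonneg ε)
  nlinarith [mul_le_mul_of_nonneg_right h10 (mul_self_nonneg d), sq_pos_of_pos hd]

/-- approximate central symmetry of the horizontal projection -/
def Refl (h : X → ℂ) (A : Set X) (x0 : X) (κ L : ℝ) : Prop :=
  ∀ c ∈ A, ∀ w ∈ A, dist x0 c ≤ L → dist x0 w ≤ L →
    dist c w ≤ ‖h c - h w‖ + κ * L ∧
      ∃ u ∈ A, dist c u ≤ dist c w ∧ ‖h u - 2 * h c + h w‖ ≤ κ * L

end

section
variable {X : Type*} [MetricSpace X] [MeasurableSpace X] [BorelSpace X]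
  {μ : Measure X} [IsFiniteMeasure μ] {α δ r0 : ℝ} {A : Set X} {x0 : X}
  {h : X → ℂ} {v : X → ℝ} {ε : ℝ}

theorem Unif.far_point (hU : Unif μ α δ r0 A x0) (hα : 0 < α) (hδ : 0 ≤ δ) {σ L : ℝ}
    (hσ : 0 < σ) (hσ1 : σ ≤ 1) (hδσ : δ ≤ (σ / 2) ^ α / 8) (hL : 0 < L) (hLr : 10 * L < r0)
    {c w : X} (hc : c ∈ A) (hw : w ∈ A) (hcL : dist x0 c ≤ L) (hwL : dist x0 w ≤ L)
    (hd : 20 * (σ * L) ≤ dist c w) :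
    ∃ u ∈ A, dist c u ≤ dist c w - 2 * (σ * L) ∧ 2 * dist c w - 5 * (σ * L) < dist w u := by
  set d := dist c w with hdd
  set s := σ * L with hs
  have hs0 : 0 < s := by positivity
  have hd2 : d ≤ 2 * L := by linarith [dist_triangle_left c w x0]
  have hsL : s ≤ L := by nlinarith
  by_contra hcon
  push Not at hcon
  have h1 := hU.lower c hc (d - 2 * s) (by linarith) (by linarith)
  have h2 := hU.lower w hw s hs0 (by linarith)
  have h3 := hU.dens (4 * L) (by linarith) (by linarith)
  have h4 := measureReal_inter_add_sdiff (μ := μ) (s := closedBall c (d - 2 * s))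
    hU.compact.measurableSet
  have h5 : μ.real (closedBall c (d - 2 * s) \ A) ≤ μ.real (closedBall x0 (4 * L) \ A) := by
    refine measureReal_mono (Set.sdiff_subset_sdiff_left ?_)
    refine closedBall_subset_closedBall' ?_
    rw [dist_comm]; linarith
  have hdisj : Disjoint (closedBall c (d - 2 * s) ∩ A) (closedBall w s) :=
    (closedBall_disjoint_closedBall (by linarith)).mono_left Set.inter_subset_left
  have h6 := measureReal_union (μ := μ) hdisj isClosed_closedBall.measurableSet
  have h7 : μ.real (closedBall c (d - 2 * s) ∩ A ∪ closedBall w s) ≤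
      (1 + δ) * (2 * (d - 2 * s)) ^ α := by
    refine hU.upper _ _ (by linarith) (by linarith)
      ⟨c, Or.inl ⟨mem_closedBall_self (by linarith), hc⟩, hc⟩ ?_
    have hx : ∀ a ∈ closedBall c (d - 2 * s) ∩ A, ∀ b ∈ closedBall w s,
        dist a b ≤ 2 * (d - 2 * s) := by
      intro a ha b hb
      have h8 := hcon a ha.2 (by rw [dist_comm]; exact ha.1)
      rw [mem_closedBall] at hb
      linarith [dist_triangle a w b, dist_comm a w, dist_comm w b]
    rintro a (ha | ha) b (hb | hb)
    · have ha1 := mem_closedBall.1 ha.1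
      have hb1 := mem_closedBall.1 hb.1
      linarith [dist_triangle_right a b c]
    · exact hx a ha b hb
    · rw [dist_comm]; exact hx b hb a ha
    · rw [mem_closedBall] at ha hb
      linarith [dist_triangle_right a b w]
  have h8 : (2 * (d - 2 * s)) ^ α ≤ (4 * L) ^ α :=
    Real.rpow_le_rpow (by linarith) (by linarith) hα.le
  have h9 : (2 * s) ^ α = (σ / 2) ^ α * (4 * L) ^ α := by
    rw [← Real.mul_rpow (by positivity) (by positivity)]
    congr 1; rw [hs]; ring
  have h10 : 0 < (4 * L) ^ α := Real.rpow_pos_of_pos (by linarith) _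
  have h11 : 0 < (σ / 2) ^ α := Real.rpow_pos_of_pos (by linarith) _
  have h12 : (σ / 2) ^ α ≤ 1 := Real.rpow_le_one (by linarith) (by linarith) hα.le
  rw [h9] at h2
  set Q := (4 * L) ^ α
  set q := (σ / 2) ^ α
  set W := (2 * (d - 2 * s)) ^ α
  have h13 : (1 - δ) * (q * Q) ≤ 3 * δ * Q := by nlinarith
  have h14 : (1 - δ) * q ≤ 3 * δ := by
    by_contra hc'
    push Not at hc'
    nlinarith
  nlinarith

theorem Unif.refl (hU : Unif μ α δ r0 A x0) (hB : IsBox h v ε) (hε : 0 < ε) (hε2 : ε ≤ 1 / 2)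
    (hα : 0 < α) (hδ : 0 ≤ δ) {κ L : ℝ} (hκ : 0 < κ) (hκ1 : κ ≤ 1)
    (hδσ : δ ≤ (κ ^ 2 / 100 / 2) ^ α / 8) (hL : 0 < L) (hLr : 10 * L < r0) :
    Refl h A x0 κ L := by
  intro c hc w hw hcL hwL
  have hκL : 0 < κ * L := by positivity
  by_cases hd : dist c w ≤ κ * L / 4
  · refine ⟨by linarith [norm_nonneg (h c - h w)], w, hw, le_rfl, ?_⟩
    have e : h w - 2 * h c + h w = 2 * (h w - h c) := by ring
    rw [e, norm_mul, Complex.norm_ofNat]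
    linarith [hB.norm_le c w]
  · push Not at hd
    have hsq : κ ^ 2 ≤ κ := by nlinarith
    have hs20 : 20 * (κ ^ 2 / 100 * L) ≤ dist c w := by nlinarith
    obtain ⟨u, hu, hcu, hwu⟩ := hU.far_point hα hδ (σ := κ ^ 2 / 100) (by positivity) (by linarith)
      hδσ hL hLr hc hw hcL hwL hs20
    set s := κ ^ 2 / 100 * L with hs
    have hs0 : 0 < s := by positivity
    have hd2 : dist c w ≤ 2 * L := by linarith [dist_triangle_left c w x0]
    have hh := hB.horiz hε hε2 (show 0 < dist c w by linarith) hs20 le_rfl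
      (by linarith) hwu
    set d := dist c w with hdd
    have hcu' : dist c u ≤ d := by linarith
    have n1 := hB.norm_le c u
    have n2 := hB.norm_le c w
    have n3 : ‖h u - h w‖ ≤ ‖h u - h c‖ + ‖h w - h c‖ := by
      have := norm_sub_le (h u - h c) (h w - h c)
      rwa [sub_sub_sub_cancel_right] at this
    refine ⟨?_, u, hu, hcu', ?_⟩
    · rw [norm_sub_rev]
      nlinarith
    · have e : h u - 2 * h c + h w = (h u - h c) + (h w - h c) := by ring
      have hp := parallelogram_law_with_norm ℝ (h u - h c) (h w - h c)
      rw [sub_sub_sub_cancel_right] at hp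
      rw [e]
      refine abs_le_of_sq_le_sq' ?_ hκL.le |>.2
      have k1 : ‖h u - h c‖ ^ 2 ≤ d ^ 2 := pow_le_pow_left₀ (norm_nonneg _) (by linarith) 2
      have k2 : ‖h w - h c‖ ^ 2 ≤ d ^ 2 := pow_le_pow_left₀ (norm_nonneg _) (by linarith) 2
      have k3 : (2 * d - 5 * s) ^ 2 ≤ ‖h u - h w‖ ^ 2 :=
        pow_le_pow_left₀ (by linarith) (by linarith) 2
      have k4 : 20 * d * s ≤ (κ * L) ^ 2 := by
        have : d * s ≤ 2 * L * s := mul_le_mul_of_nonneg_right hd2 hs0.le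
        have e2 : 2 * L * s = (κ * L) ^ 2 / 50 := by rw [hs]; ring
        nlinarith [sq_nonneg (κ * L)]
      nlinarith [sq_nonneg s]

end

section
variable {X : Type*} [MetricSpace X] {A : Set X} {x0 : X}
  {h : X → ℂ} {v : X → ℝ} {ε : ℝ}

theorem Refl.trans {κ L R : ℝ} (hR : Refl h A x0 κ L) (hx : x0 ∈ A) (hL : 0 ≤ L) {p w : X}
    (hp : p ∈ A)
    (hpR : dist x0 p ≤ R) (hpL : R ≤ L) (hw : w ∈ A) (hwL : dist x0 w ≤ L) :
    ∃ u ∈ A, dist x0 u ≤ dist x0 w + 2 * R ∧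
      ‖(h u - h x0) - ((h w - h x0) + 2 * (h p - h x0))‖ ≤ 2 * (κ * L) := by
  obtain ⟨-, u, hu, hu1, hu2⟩ := hR x0 hx w hw (by simpa using hL) hwL
  obtain ⟨-, u', hu', hu1', hu2'⟩ := hR p hp u hu (by linarith) (by linarith)
  refine ⟨u', hu', ?_, ?_⟩
  · linarith [dist_triangle x0 p u', dist_triangle p x0 u, dist_comm p x0]
  · have e : (h u' - h x0) - ((h w - h x0) + 2 * (h p - h x0)) =
        (h u' - 2 * h p + h u) - (h u - 2 * h x0 + h w) := by ring
    rw [e]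
    linarith [norm_sub_le (h u' - 2 * h p + h u) (h u - 2 * h x0 + h w)]

theorem Refl.lattice {κ L R : ℝ} (hR : Refl h A x0 κ L) (hx : x0 ∈ A) (hR0 : 0 ≤ R) (hκ : 0 ≤ κ)
    (hL : 0 ≤ L) {p q : X} (hp : p ∈ A)
    (hq : q ∈ A) (hpR : dist x0 p ≤ R) (hqR : dist x0 q ≤ R) {N : ℕ} (hN : 1 ≤ N)
    (hNL : 10 * N * R ≤ L) :
    ∀ j : ℕ, j ≤ N → ∀ i : ℕ, i ≤ N → ∃ a ∈ A, dist x0 a ≤ 2 * (i + j) * R ∧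
      ‖(h a - h x0) - (i * (2 * (h p - h x0)) + j * (2 * (h q - h x0)))‖ ≤
        2 * (i + j) * (κ * L) := by
  have hN1 : (1 : ℝ) ≤ N := by exact_mod_cast hN
  have hRN : R ≤ N * R := by nlinarith
  have hRL : R ≤ L := by linarith
  intro j
  induction j with
  | zero =>
    intro _ i
    induction i with
    | zero => intro _; exact ⟨x0, hx, by simp, by simp⟩
    | succ i ih =>
      intro hi
      obtain ⟨a, ha, ha1, ha2⟩ := ih (by omega)
      have hiN : (i : ℝ) + 1 ≤ N := by exact_mod_cast hi
      have hiN' : ((i : ℝ) + 1) * R ≤ N * R := mul_le_mul_of_nonneg_right hiN hR0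
      push_cast at *
      obtain ⟨u, hu, hu1, hu2⟩ := hR.trans hx hL hp hpR hRL ha (by nlinarith)
      refine ⟨u, hu, by linarith, ?_⟩
      have e : (h u - h x0) - (((i : ℂ) + 1) * (2 * (h p - h x0)) + 0 * (2 * (h q - h x0))) =
        ((h u - h x0) - ((h a - h x0) + 2 * (h p - h x0))) +
        ((h a - h x0) - ((i : ℂ) * (2 * (h p - h x0)) + 0 * (2 * (h q - h x0)))) := by ring
      rw [e]
      refine (norm_add_le _ _).trans ?_
      linarith
  | succ j ihj =>
    intro hj i hi
    obtain ⟨a, ha, ha1, ha2⟩ := ihj (by omega) i hi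
    have hjN : (j : ℝ) + 1 ≤ N := by exact_mod_cast hj
    have hjN' : ((j : ℝ) + 1) * R ≤ N * R := mul_le_mul_of_nonneg_right hjN hR0
    have hiN : (i : ℝ) ≤ N := by exact_mod_cast hi
    have hiN' : (i : ℝ) * R ≤ N * R := mul_le_mul_of_nonneg_right hiN hR0
    push_cast at *
    obtain ⟨u, hu, hu1, hu2⟩ := hR.trans hx hL hq hqR hRL ha (by nlinarith)
    refine ⟨u, hu, by linarith, ?_⟩
    have e : (h u - h x0) - ((i : ℂ) * (2 * (h p - h x0)) + ((j : ℂ) + 1) * (2 * (h q - h x0))) =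
        ((h u - h x0) - ((h a - h x0) + 2 * (h q - h x0))) +
        ((h a - h x0) - ((i : ℂ) * (2 * (h p - h x0)) + (j : ℂ) * (2 * (h q - h x0)))) := by ring
    rw [e]
    refine (norm_add_le _ _).trans ?_
    linarith

theorem IsBox.neighbour (hB : IsBox h v ε) (hε : 0 < ε) {w w' : X} {U U' : ℂ} {R M η : ℝ}
    (hR0 : 0 ≤ R) (hη : 0 ≤ η)
    (hd : dist w w' ≤ 5 * R) (h1 : ‖(h w - h x0) - U‖ ≤ η * R) (h2 : ‖(h w' - h x0) - U'‖ ≤ η * R)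
    (hM : ‖U‖ ≤ M * R) (hM' : ‖h w' - h x0‖ ≤ M * R) (hηM : 4 * M * η ≤ 1) :
    |(v w' - v x0 - 2 * om (h x0) (h w')) - (v w - v x0 - 2 * om (h x0) (h w)) - 2 * om U U'| ≤
      (25 / ε ^ 2 + 1) * R ^ 2 := by
  have k1 := hB.vert_le hε w w'
  have k2 : |v w' - v w - 2 * om (h w) (h w')| ≤ 25 / ε ^ 2 * R ^ 2 := by
    rw [div_mul_eq_mul_div, le_div_iff₀ (by positivity)]
    have := pow_le_pow_left₀ dist_nonneg hd 2
    nlinarith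
  have k3 := abs_om_le ((h w - h x0) - U) (h w' - h x0)
  have k4 := abs_om_le U ((h w' - h x0) - U')
  have k5 : ‖(h w - h x0) - U‖ * ‖h w' - h x0‖ ≤ (η * R) * (M * R) :=
    mul_le_mul h1 hM' (norm_nonneg _) (by positivity)
  have k6 : ‖U‖ * ‖(h w' - h x0) - U'‖ ≤ (M * R) * (η * R) :=
    mul_le_mul hM h2 (norm_nonneg _) ((norm_nonneg _).trans hM)
  have k7 : 4 * M * η * R ^ 2 ≤ 1 * R ^ 2 := mul_le_mul_of_nonneg_right hηM (sq_nonneg _)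
  have e : (v w' - v x0 - 2 * om (h x0) (h w')) - (v w - v x0 - 2 * om (h x0) (h w)) - 2 * om U U'
    = (v w' - v w - 2 * om (h w) (h w')) + 2 * om ((h w - h x0) - U) (h w' - h x0) +
      2 * om U ((h w' - h x0) - U') := by
    simp only [om, Complex.sub_re, Complex.sub_im]; ring
  rw [e]
  refine (abs_add_three _ _ _).trans ?_
  rw [abs_mul, abs_mul, abs_two]
  nlinarith

theorem lattice_sum (f : ℕ → ℕ → ℝ) (N : ℕ) (Ω C : ℝ)
    (h1 : ∀ i j, i < N → j ≤ N → |f (i + 1) j - f i j - 2 * (-(j * Ω))| ≤ C)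
    (h2 : ∀ i j, i ≤ N → j < N → |f i (j + 1) - f i j - 2 * (i * Ω)| ≤ C) :
    N ^ 2 * |Ω| ≤ N * C := by
  have a1 : ∀ j ≤ N, ∀ i ≤ N, |f i j - f 0 j + 2 * i * j * Ω| ≤ i * C := by
    intro j hj i
    induction i with
    | zero => intro _; simp
    | succ i ih =>
      intro hi
      have := ih (by omega)
      have := h1 i j (by omega) hj
      push_cast
      rw [abs_le] at *
      constructor <;> linarith
  have a2 : ∀ i ≤ N, ∀ j ≤ N, |f i j - f i 0 - 2 * i * j * Ω| ≤ j * C := by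
    intro i hi j
    induction j with
    | zero => intro _; simp
    | succ j ih =>
      intro hj
      have := ih (by omega)
      have := h2 i j hi (by omega)
      push_cast
      rw [abs_le] at *
      constructor <;> linarith
  have b1 := a1 0 (by omega) N le_rfl
  have b2 := a1 N le_rfl N le_rfl
  have b3 := a2 0 (by omega) N le_rfl
  have b4 := a2 N le_rfl N le_rfl
  push_cast at *
  rcases abs_cases Ω with ⟨e, _⟩ | ⟨e, _⟩ <;> rw [e] <;> rw [abs_le] at b1 b2 b3 b4 <;> nlinarith

theorem Refl.no_transverse {κ L R θ : ℝ} (hRf : Refl h A x0 κ L) (hB : IsBox h v ε) (hε : 0 < ε)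
    (hx : x0 ∈ A) (hR0 : 0 < R) {N : ℕ} (hN : 1 ≤ N) (hL : L = 10 * N * R)
    (hκ : κ = 1 / (1000 * N ^ 3)) {p q : X} (hp : p ∈ A)
    (hq : q ∈ A) (hpR : dist x0 p ≤ R) (hqR : dist x0 q ≤ R)
    (hpq : θ * R ^ 2 ≤ |om (h p - h x0) (h q - h x0)|) : 4 * N * θ ≤ 25 / ε ^ 2 + 1 := by
  have hN1 : (1 : ℝ) ≤ N := by exact_mod_cast hN
  have hκ0 : 0 < κ := by rw [hκ]; positivity
  have hL0 : 0 < L := by rw [hL]; positivity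
  have hlat := hRf.lattice hx hR0.le hκ0.le hL0.le hp hq hpR hqR hN hL.ge
  have hlat' : ∀ i j : ℕ, ∃ a, i ≤ N → j ≤ N → a ∈ A ∧ dist x0 a ≤ 2 * (i + j) * R ∧
      ‖(h a - h x0) - (i * (2 * (h p - h x0)) + j * (2 * (h q - h x0)))‖ ≤
        2 * (i + j) * (κ * L) := by
    intro i j
    by_cases hij : i ≤ N ∧ j ≤ N
    · obtain ⟨a, ha⟩ := hlat j hij.2 i hij.1
      exact ⟨a, fun _ _ => ha⟩
    · exact ⟨x0, fun h1 h2 => absurd ⟨h1, h2⟩ hij⟩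
  choose a ha using hlat'
  set P := 2 * (h p - h x0) with hP
  set Q := 2 * (h q - h x0) with hQ
  have hPn : ‖P‖ ≤ 2 * R := by
    rw [hP, norm_mul, Complex.norm_ofNat]; linarith [hB.norm_le x0 p]
  have hQn : ‖Q‖ ≤ 2 * R := by
    rw [hQ, norm_mul, Complex.norm_ofNat]; linarith [hB.norm_le x0 q]
  have hκL : κ * L = 1 / (100 * N ^ 2) * R := by
    rw [hκ, hL]; field_simp; norm_num
  have hκLR : κ * L ≤ R := by
    rw [hκL]
    have : 1 / (100 * (N : ℝ) ^ 2) ≤ 1 := by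
      rw [div_le_one (by positivity)]; nlinarith
    nlinarith
  -- bounds for indices
  have hb : ∀ i j : ℕ, i ≤ N → j ≤ N → a i j ∈ A ∧ dist x0 (a i j) ≤ 4 * N * R ∧
      ‖(h (a i j) - h x0) - (i * P + j * Q)‖ ≤ 1 / (16 * N) * R ∧
      ‖(i * P + j * Q)‖ ≤ 4 * N * R := by
    intro i j hi hj
    obtain ⟨b1, b2, b3⟩ := ha i j hi hj
    have hi' : (i : ℝ) ≤ N := by exact_mod_cast hi
    have hj' : (j : ℝ) ≤ N := by exact_mod_cast hj
    refine ⟨b1, b2.trans ?_, b3.trans ?_, ?_⟩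
    · exact mul_le_mul_of_nonneg_right (by linarith) hR0.le
    · have : 2 * ((i : ℝ) + j) * (κ * L) ≤ 4 * N * (κ * L) :=
        mul_le_mul_of_nonneg_right (by linarith) (by positivity)
      refine this.trans ?_
      rw [hκL, ← mul_assoc]
      gcongr
      rw [mul_one_div, div_le_div_iff₀ (by positivity) (by positivity)]
      nlinarith
    · refine (norm_add_le _ _).trans ?_
      rw [norm_mul (i : ℂ), norm_mul (j : ℂ), Complex.norm_natCast, Complex.norm_natCast]
      have := mul_le_mul hi' hPn (norm_nonneg _) (by positivity)
      have := mul_le_mul hj' hQn (norm_nonneg _) (by positivity)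
      linarith
  have hη1 : 1 / (16 * (N : ℝ)) ≤ 1 := by rw [div_le_one (by positivity)]; linarith
  have hηR : 1 / (16 * (N : ℝ)) * R ≤ R := by nlinarith
  have hstep : ∀ i j i' j' : ℕ, i ≤ N → j ≤ N → i' ≤ N → j' ≤ N →
      ‖((i' : ℂ) * P + j' * Q) - (i * P + j * Q)‖ ≤ 2 * R →
      |(v (a i' j') - v x0 - 2 * om (h x0) (h (a i' j'))) -
        (v (a i j) - v x0 - 2 * om (h x0) (h (a i j))) -
        2 * om (i * P + j * Q) (i' * P + j' * Q)| ≤ (25 / ε ^ 2 + 1) * R ^ 2 := by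
    intro i j i' j' hi hj hi' hj' hn
    obtain ⟨b1, b2, b3, b4⟩ := hb i j hi hj
    obtain ⟨c1, c2, c3, c4⟩ := hb i' j' hi' hj'
    refine hB.neighbour hε hR0.le (η := 1 / (16 * N)) (M := 4 * N) (by positivity) ?_ b3 c3 b4
      ((hB.norm_le _ _).trans c2) ?_
    · have hNR : 0 ≤ N * R := by positivity
      have d1 := (hRf _ c1 _ b1 (by rw [hL]; linarith) (by rw [hL]; linarith)).1
      rw [dist_comm]
      refine d1.trans ?_
      have e : h (a i' j') - h (a i j) =
        ((h (a i' j') - h x0) - (i' * P + j' * Q)) - ((h (a i j) - h x0) - (i * P + j * Q)) +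
        (((i' : ℂ) * P + j' * Q) - (i * P + j * Q)) := by ring
      have e1 : ‖h (a i' j') - h (a i j)‖ ≤ R + R + 2 * R := by
        rw [e]
        refine (norm_add_le _ _).trans (add_le_add ((norm_sub_le _ _).trans ?_) hn)
        linarith
      linarith
    · apply le_of_eq; field_simp; norm_num
  have hfin := lattice_sum (fun i j => v (a i j) - v x0 - 2 * om (h x0) (h (a i j))) N (om P Q)
    ((25 / ε ^ 2 + 1) * R ^ 2) (by
      intro i j hi hj
      have := hstep i j (i + 1) j hi.le hj hi hj (by
        have e : (((i + 1 : ℕ) : ℂ) * P + j * Q) - (i * P + j * Q) = P := by push_cast; ring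
        rw [e]; exact hPn)
      have e : om (i * P + j * Q) (((i + 1 : ℕ) : ℂ) * P + j * Q) = -(j * om P Q) := by
        simp [om]; ring
      rwa [e] at this) (by
      intro i j hi hj
      have := hstep i j i (j + 1) hi hj.le hi hj (by
        have e : ((i : ℂ) * P + (j + 1 : ℕ) * Q) - (i * P + j * Q) = Q := by push_cast; ring
        rw [e]; exact hQn)
      have e : om (i * P + j * Q) ((i : ℂ) * P + (j + 1 : ℕ) * Q) = i * om P Q := by
        simp [om]; ring
      rwa [e] at this)
  have e4 : om P Q = 4 * om (h p - h x0) (h q - h x0) := by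
    simp [hP, hQ, om]; ring
  rw [e4, abs_mul, abs_of_pos (by norm_num : (0 : ℝ) < 4)] at hfin
  set W := |om (h p - h x0) (h q - h x0)|
  have hN0 : (0 : ℝ) < N := by linarith
  have g1 : N * (4 * W) ≤ (25 / ε ^ 2 + 1) * R ^ 2 := by
    have : (N : ℝ) * (N * (4 * W)) ≤ N * ((25 / ε ^ 2 + 1) * R ^ 2) := by linarith
    exact le_of_mul_le_mul_left this hN0
  have g2 : (4 * N * θ) * R ^ 2 ≤ (25 / ε ^ 2 + 1) * R ^ 2 := by
    have := mul_le_mul_of_nonneg_left hpq hN0.le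
    linarith
  exact le_of_mul_le_mul_right g2 (by positivity)

end

section
variable {X : Type*} [MetricSpace X] [MeasurableSpace X] [BorelSpace X]
  {μ : Measure X} [IsFiniteMeasure μ] {α δ r0 : ℝ} {A : Set X} {x0 : X}
  {h : X → ℂ} {v : X → ℝ} {ε : ℝ}

theorem Unif.transverse (hU : Unif μ α δ r0 A x0) (hB : IsBox h v ε)
    (hα : 1 < α) (hδ : 0 ≤ δ) (hδ1 : δ ≤ 1 / 10) {κ L R : ℝ} (hRf : Refl h A x0 κ L)
    {M : ℕ} (hM : 1 ≤ M) (hMα : 3 * M * (13 / M : ℝ) ^ α ≤ 1) (hR : 0 < R) (hRL : R ≤ L)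
    (hRr : 13 * R < r0) (hκ4 : κ * L ≤ R / 4) (hκM : κ * L ≤ R / M) :
    ∃ p ∈ A, ∃ q ∈ A, dist x0 p ≤ R ∧ dist x0 q ≤ R ∧
      1 / M * R ^ 2 ≤ |om (h p - h x0) (h q - h x0)| := by
  have hM1 : (1 : ℝ) ≤ M := by exact_mod_cast hM
  have hM0 : (0 : ℝ) < M := by linarith
  have hmass := hU.mass hR (by linarith)
  have h2α : (2 : ℝ) ≤ 2 ^ α := by
    have := Real.rpow_le_rpow_of_exponent_le (one_le_two (α := ℝ)) hα.le
    rwa [Real.rpow_one] at this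
  have hRα : 0 < R ^ α := Real.rpow_pos_of_pos hR _
  rw [Real.mul_rpow (by norm_num) hR.le] at hmass
  have hmass' : 17 / 10 * R ^ α ≤ μ.real (closedBall x0 R ∩ A) := by
    have : 2 * R ^ α ≤ 2 ^ α * R ^ α := mul_le_mul_of_nonneg_right h2α hRα.le
    nlinarith
  obtain ⟨p, hpA, hpR, hp⟩ : ∃ p ∈ A, dist x0 p ≤ R ∧ R / 4 ≤ ‖h p - h x0‖ := by
    by_contra hcon
    push Not at hcon
    have := hU.upper (closedBall x0 R ∩ A) R hR.le (by linarith)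
      ⟨x0, ⟨mem_closedBall_self hR.le, hU.mem⟩, hU.mem⟩ (by
        have hx : ∀ a ∈ closedBall x0 R ∩ A, dist x0 a ≤ R / 2 := by
          rintro a ⟨ha, haA⟩
          rw [mem_closedBall, dist_comm] at ha
          have h1 := hcon a haA ha
          have h2 := (hRf x0 hU.mem a haA (by rw [dist_self]; linarith) (by linarith)).1
          rw [norm_sub_rev] at h2
          linarith
        intro a ha b hb
        linarith [hx a ha, hx b hb, dist_triangle_left a b x0])
    nlinarith
  refine ⟨p, hpA, ?_⟩
  by_contra hcon
  push Not at hcon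
  have hpn : ‖h p - h x0‖ ≤ R := (hB.norm_le x0 p).trans hpR
  set z : X → ℂ := fun q => (starRingEnd ℂ) (h p - h x0) * (h q - h x0) with hz
  set S : ℤ → Set X := fun k => {q ∈ closedBall x0 R ∩ A | ⌊(z q).re * M / R ^ 2⌋ = k} with hS
  have hcov : closedBall x0 R ∩ A ⊆ ⋃ k ∈ Finset.Icc (-(M : ℤ)) M, S k := by
    rintro q ⟨hq, hqA⟩
    have hq' := hq
    rw [mem_closedBall, dist_comm] at hq'
    have h1 : |(z q).re| ≤ R ^ 2 := by
      refine (Complex.abs_re_le_norm _).trans ?_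
      rw [hz, norm_mul, Complex.norm_conj, sq]
      exact mul_le_mul hpn ((hB.norm_le x0 q).trans hq') (norm_nonneg _) hR.le
    rw [abs_le] at h1
    refine Set.mem_iUnion₂.2 ⟨⌊(z q).re * M / R ^ 2⌋, ?_, ⟨hq, hqA⟩, rfl⟩
    rw [Finset.mem_Icc]
    constructor
    · rw [Int.le_floor]
      push_cast
      rw [le_div_iff₀ (by positivity)]
      nlinarith
    · have : (z q).re * M / R ^ 2 ≤ M := by
        rw [div_le_iff₀ (by positivity)]
        nlinarith
      exact_mod_cast (Int.floor_le _).trans this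
  have hpiece : ∀ k, μ.real (S k) ≤ (1 + δ) * (13 / M * R) ^ α := by
    intro k
    by_cases hne : (S k).Nonempty
    · obtain ⟨q0, hq0⟩ := hne
      have hMR : 13 / (M : ℝ) * R ≤ 13 * R := by
        gcongr
        exact div_le_self (by norm_num) hM1
      refine hU.upper _ _ (by positivity) (by linarith) ⟨q0, hq0, hq0.1.2⟩ ?_
      rintro a ⟨⟨ha, haA⟩, hak⟩ b ⟨⟨hb, hbA⟩, hbk⟩
      rw [mem_closedBall, dist_comm] at ha hb
      have ia := hcon a haA hpR ha
      have ib := hcon b hbA hpR hb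
      rw [om_eq] at ia ib
      change |(z a).im| < _ at ia
      change |(z b).im| < _ at ib
      have hre : |(z a - z b).re| ≤ 1 / M * R ^ 2 := by
        have h1 := Int.abs_sub_lt_one_of_floor_eq_floor (hak.trans hbk.symm)
        have e : (z a).re * M / R ^ 2 - (z b).re * M / R ^ 2 = (z a - z b).re * (M / R ^ 2) := by
          rw [Complex.sub_re]; ring
        rw [e, abs_mul, abs_of_pos (show (0 : ℝ) < M / R ^ 2 by positivity), ← lt_div_iff₀
          (by positivity), one_div_div] at h1
        refine h1.le.trans (le_of_eq (by ring))
      have him : |(z a - z b).im| ≤ 2 * (1 / M * R ^ 2) := by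
        rw [Complex.sub_im]
        refine (abs_sub _ _).trans ?_
        linarith
      have hzz : ‖z a - z b‖ ≤ 3 * (1 / M * R ^ 2) :=
        (Complex.norm_le_abs_re_add_abs_im _).trans (by linarith)
      have e2 : z a - z b = (starRingEnd ℂ) (h p - h x0) * (h a - h b) := by
        simp only [hz]; ring
      rw [e2, norm_mul, Complex.norm_conj] at hzz
      have h3 : R / 4 * ‖h a - h b‖ ≤ R / 4 * (12 / M * R) := by
        refine (mul_le_mul_of_nonneg_right hp (norm_nonneg _)).trans (hzz.trans (le_of_eq ?_))
        ring
      have h4 := le_of_mul_le_mul_left h3 (by positivity)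
      have h5 := (hRf a haA b hbA (by linarith) (by linarith)).1
      refine h5.trans ((add_le_add h4 hκM).trans (le_of_eq ?_))
      ring
    · rw [Set.not_nonempty_iff_eq_empty.1 hne, measureReal_empty]
      positivity
  have h1 : μ.real (closedBall x0 R ∩ A) ≤ ∑ k ∈ Finset.Icc (-(M : ℤ)) M, μ.real (S k) :=
    (measureReal_mono hcov (measure_ne_top _ _)).trans (measureReal_biUnion_finset_le _ _)
  have h2 := h1.trans (Finset.sum_le_sum fun k _ => hpiece k)
  rw [Finset.sum_const, nsmul_eq_mul, Int.card_Icc, Real.mul_rpow (by positivity) hR.le] at h2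
  have e3 : (((M : ℤ) + 1 - -(M : ℤ)).toNat : ℝ) ≤ 3 * M := by
    have : ((M : ℤ) + 1 - -(M : ℤ)).toNat ≤ 3 * M := by omega
    exact_mod_cast this
  have h3 : 0 ≤ (1 + δ) * ((13 / M : ℝ) ^ α * R ^ α) := by positivity
  have h4 := h2.trans (mul_le_mul_of_nonneg_right e3 h3)
  have h5 : 3 * M * ((1 + δ) * ((13 / M : ℝ) ^ α * R ^ α)) =
    (3 * M * (13 / M : ℝ) ^ α) * ((1 + δ) * R ^ α) := by ring
  rw [h5] at h4
  have h6 := h4.trans (mul_le_mul_of_nonneg_right hMα (by positivity))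
  nlinarith

end

theorem exists_M {α : ℝ} (hα : 1 < α) : ∃ M : ℕ, 1 ≤ M ∧ 3 * M * (13 / M : ℝ) ^ α ≤ 1 := by
  have h1 : Tendsto (fun M : ℕ => 3 * (13 : ℝ) ^ α * (M : ℝ) ^ (-(α - 1))) atTop
      (𝓝 (3 * (13 : ℝ) ^ α * 0)) :=
    ((tendsto_rpow_neg_atTop (by linarith)).comp tendsto_natCast_atTop_atTop).const_mul _
  rw [mul_zero] at h1
  obtain ⟨M, hM1, hM⟩ := ((eventually_ge_atTop 1).and (h1.eventually (gt_mem_nhds one_pos))).exists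
  refine ⟨M, hM1, le_trans (le_of_eq ?_) hM.le⟩
  have hM0 : (0 : ℝ) < M := by exact_mod_cast hM1
  rw [Real.div_rpow (by norm_num) hM0.le, neg_sub, Real.rpow_sub hM0, Real.rpow_one]
  ring

theorem no_big {α ε : ℝ} (hα : 1 < α) (hε : 0 < ε) (hε2 : ε ≤ 1 / 2) :
    ∃ δ : ℝ, 0 < δ ∧ δ < 1 ∧ ∀ {X : Type} [MetricSpace X] [MeasurableSpace X] [BorelSpace X]
      {μ : Measure X} [IsFiniteMeasure μ] {r0 : ℝ} {A : Set X} {x0 : X}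
      {h : X → ℂ} {v : X → ℝ}, IsBox h v ε → ¬ Unif μ α δ r0 A x0 := by
  obtain ⟨M, hM, hMα⟩ := exists_M hα
  have hM1 : (1 : ℝ) ≤ M := by exact_mod_cast hM
  obtain ⟨N, hN⟩ := exists_nat_gt (max (M : ℝ) ((25 / ε ^ 2 + 1) * M))
  have hNM : (M : ℝ) < N := (le_max_left _ _).trans_lt hN
  have hN2 : (25 / ε ^ 2 + 1) * M < N := (le_max_right _ _).trans_lt hN
  have hN1 : (1 : ℝ) ≤ N := by linarith
  have hN1' : 1 ≤ N := by exact_mod_cast hN1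
  set κ : ℝ := 1 / (1000 * N ^ 3) with hκ
  have hκ0 : 0 < κ := by positivity
  have hκ1 : κ ≤ 1 := by
    rw [hκ, div_le_one (by positivity)]
    have := one_le_pow₀ hN1 (n := 3)
    linarith
  have hq : 0 < (κ ^ 2 / 100 / 2) ^ α / 8 := by positivity
  refine ⟨min (1 / 10) ((κ ^ 2 / 100 / 2) ^ α / 8), lt_min (by norm_num) hq,
    (min_le_left _ _).trans_lt (by norm_num), ?_⟩
  intro X _ _ _ μ _ r0 A x0 h v hB hU
  have hδ0 : 0 ≤ min (1 / 10) ((κ ^ 2 / 100 / 2) ^ α / 8) := le_min (by norm_num) hq.le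
  have hr0 := hU.pos
  obtain ⟨R, hR⟩ : ∃ R, R = r0 / (200 * N) := ⟨_, rfl⟩
  have hR0 : 0 < R := by rw [hR]; positivity
  have hRr : 200 * (N * R) = r0 := by rw [hR]; field_simp
  have hNR : R ≤ N * R := by nlinarith
  have hRf := hU.refl hB hε hε2 (by linarith) hδ0 hκ0 hκ1 (min_le_right _ _)
    (L := 10 * N * R) (by positivity) (by linarith)
  have hκL : κ * (10 * N * R) = R / (100 * N ^ 2) := by
    rw [hκ]; field_simp; norm_num
  have hNN : (N : ℝ) ≤ 100 * N ^ 2 := by nlinarith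
  obtain ⟨p, hp, q, hq', hpR, hqR, hpq⟩ := hU.transverse hB hα hδ0 (min_le_left _ _) hRf hM hMα hR0
    (by linarith) (by linarith) (by
      rw [hκL]
      exact div_le_div_of_nonneg_left hR0.le (by norm_num) (by nlinarith)) (by
      rw [hκL]
      exact div_le_div_of_nonneg_left hR0.le (by linarith) (by linarith))
  have := hRf.no_transverse hB hε hU.mem hR0 hN1' rfl hκ hp hq' hpR hqR hpq
  rw [mul_one_div, div_le_iff₀ (by linarith)] at this
  linarith

theorem exhaust {X : Type*} [MeasurableSpace X] (μ : Measure X) [IsFiniteMeasure μ]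
    (P : Set X → Prop) (hemp : P ∅) (hm : ∀ C, P C → MeasurableSet C)
    (hx : ∀ B, MeasurableSet B → μ B ≠ 0 → ∃ C ⊆ B, P C ∧ μ C ≠ 0) :
    ∃ F : ℕ → Set X, (∀ n, P (F n)) ∧ μ (⋃ n, F n)ᶜ = 0 := by
  set V : Set ℝ≥0∞ := {t | ∃ F : ℕ → Set X, (∀ n, P (F n)) ∧ t = μ (⋃ n, F n)} with hV
  have hVne : V.Nonempty := ⟨_, fun _ => ∅, fun _ => hemp, rfl⟩
  obtain ⟨t, -, ht, htV⟩ := exists_seq_tendsto_sSup hVne (OrderTop.bddAbove V)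
  choose F hF hFt using htV
  set G : ℕ → Set X := fun n => F n.unpair.1 n.unpair.2 with hG
  have hGP : ∀ n, P (G n) := fun n => hF _ _
  have hGF : ∀ k, (⋃ n, F k n) ⊆ ⋃ n, G n := by
    intro k
    refine Set.iUnion_subset fun n => ?_
    have : F k n = G (Nat.pair k n) := by simp [hG]
    rw [this]
    exact Set.subset_iUnion G _
  have hsup : sSup V ≤ μ (⋃ n, G n) :=
    le_of_tendsto' ht fun k => by rw [hFt k]; exact measure_mono (hGF k)
  refine ⟨G, hGP, ?_⟩
  by_contra hne
  have hGm : MeasurableSet (⋃ n, G n) := MeasurableSet.iUnion fun n => hm _ (hGP n)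
  obtain ⟨C, hC, hPC, hμC⟩ := hx _ hGm.compl hne
  have h1 : μ (⋃ n, (fun n => Nat.casesOn n C G : ℕ → Set X) n) ∈ V := by
    refine ⟨_, ?_, rfl⟩
    intro n
    cases n with
    | zero => exact hPC
    | succ n => exact hGP n
  have h2 : (⋃ n, G n) ∪ C ⊆ ⋃ n, (fun n => Nat.casesOn n C G : ℕ → Set X) n := by
    rintro x (hx | hx)
    · obtain ⟨n, hn⟩ := Set.mem_iUnion.1 hx
      exact Set.mem_iUnion.2 ⟨n + 1, hn⟩
    · exact Set.mem_iUnion.2 ⟨0, hx⟩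
  have h3 := measure_union (μ := μ) (Set.disjoint_left.2 fun x hx hxC => hC hxC hx : Disjoint (⋃ n, G n) C)
    (hm _ hPC)
  have h4 := (measure_mono h2).trans ((le_sSup h1).trans hsup)
  rw [h3] at h4
  exact hμC (by
    by_contra hC0
    exact absurd h4 (not_le.2 (ENNReal.lt_add_right (measure_ne_top _ _) hC0)))

theorem main_abs {X : Type} [MetricSpace X] [ProperSpace X] [MeasurableSpace X] [BorelSpace X]
    {h : X → ℂ} {v : X → ℝ} {ε : ℝ} (hB : IsBox h v ε) (hε : 0 < ε) (hε2 : ε ≤ 1 / 2)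
    {α : ℝ} (hα : 0 < α) {E : Set X} (hE : MeasurableSet E) (hpos : 0 < μH[α] E)
    (hfin : μH[α] E < ⊤)
    (hdens : ∀ᵐ x ∂((μH[α] : Measure X).restrict E),
      Tendsto (fun r : ℝ => μH[α] (E ∩ closedBall x r) / ENNReal.ofReal (2 * r) ^ α)
        (𝓝[>] 0) (𝓝 1)) :
    α = 1 ∧ ∃ (f : ℕ → ℝ → X) (A : ℕ → Set ℝ) (K : ℕ → ℝ≥0),
      (∀ i, IsCompact (A i)) ∧ (∀ i, LipschitzOnWith (K i) (f i) (A i)) ∧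
        μH[1] (E \ ⋃ i, f i '' A i) = 0 := by
  have hf : IsFiniteMeasure ((μH[α] : Measure X).restrict E) :=
    ⟨by rwa [Measure.restrict_apply_univ]⟩
  have hα1 : α = 1 := by
    rcases lt_trichotomy α 1 with hlt | heq | hgt
    · exfalso
      have g1 : (2 : ℝ) ^ α < 2 := by
        have := Real.rpow_lt_rpow_of_exponent_lt (one_lt_two (α := ℝ)) hlt
        rwa [Real.rpow_one] at this
      have g2 : (1 : ℝ) < 2 ^ α := Real.one_lt_rpow one_lt_two hα
      obtain ⟨A, r0, x0, -, hU⟩ := core_unif hα hE hfin.ne hdens subset_rfl hE hpos.ne'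
        (δ := (2 - 2 ^ α) / 10) (by linarith) (by linarith)
      have := hU.one_le hα (by linarith) (by linarith)
      nlinarith
    · exact heq
    · exfalso
      obtain ⟨δ, hδ0, hδ1, hno⟩ := no_big hgt hε hε2
      obtain ⟨A, r0, x0, -, hU⟩ := core_unif hα hE hfin.ne hdens subset_rfl hE hpos.ne' hδ0 hδ1
      exact hno hB hU
  refine ⟨hα1, ?_⟩
  subst hα1
  have hne : Nonempty X := by
    by_contra hcon
    rw [not_nonempty_iff] at hcon
    rw [Set.eq_empty_of_isEmpty E, measure_empty] at hpos
    exact lt_irrefl _ hpos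
  obtain ⟨F, hF, hF0⟩ := exhaust ((μH[1] : Measure X).restrict E)
    (fun C => ∃ (f : ℝ → X) (A : Set ℝ), IsCompact A ∧ LipschitzOnWith 10 f A ∧ f '' A = C)
    ⟨fun _ => hne.some, ∅, isCompact_empty, by simp, by simp⟩ (by
      rintro C ⟨f, A, hA, hfA, rfl⟩
      exact (hA.image_of_continuousOn hfA.continuousOn).measurableSet) (by
      intro B hBm hB0
      rw [Measure.restrict_apply hBm] at hB0
      obtain ⟨A, r0, z, hAB, hU⟩ := core_unif one_pos hE hfin.ne hdens Set.inter_subset_right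
        (hBm.inter hE) hB0 (δ := 1 / 10 ^ 8) (by norm_num) (by norm_num)
      obtain ⟨C, hCA, hCc, hC0, hCl⟩ := hU.piece (by norm_num) le_rfl (by
        intro S hS P hP
        rw [Measure.restrict_eq_self _ (hS.trans (hAB.trans Set.inter_subset_right))]
        have := hP.hausdorffMeasure_image_le zero_le_one S
        rw [hausdorffMeasure_real] at this
        simpa using this)
      refine ⟨C, hCA.trans (hAB.trans Set.inter_subset_left), ?_, hC0⟩
      have hinj : Set.InjOn (dist z) C := by
        intro a ha b hb hab
        have := hCl a ha b hb
        rw [hab, sub_self, abs_zero, mul_zero] at this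
        exact dist_le_zero.1 this
      have hinv : ∀ a ∈ C, Function.invFunOn (dist z) C (dist z a) = a :=
        fun a ha => hinj.leftInvOn_invFunOn ha
      refine ⟨Function.invFunOn (dist z) C, dist z '' C, hCc.image (by fun_prop), ?_, ?_⟩
      · refine LipschitzOnWith.of_dist_le_mul ?_
        rintro _ ⟨a, ha, rfl⟩ _ ⟨b, hb, rfl⟩
        rw [hinv a ha, hinv b hb, Real.dist_eq]
        exact hCl a ha b hb
      · exact hinj.leftInvOn_invFunOn.image_image)
  choose f A hA hfA hfF using hF
  refine ⟨f, A, fun _ => 10, hA, hfA, ?_⟩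
  have hm : MeasurableSet (⋃ n, F n)ᶜ := by
    refine (MeasurableSet.iUnion fun n => ?_).compl
    rw [← hfF n]
    exact ((hA n).image_of_continuousOn (hfA n).continuousOn).measurableSet
  rw [Measure.restrict_apply hm] at hF0
  simp only [hfF]
  rwa [Set.sdiff_eq, Set.inter_comm]


/-- horizontal part as a complex number -/
noncomputable def Heis.hc (p : Heis) : ℂ := ⟨p.h.1, p.h.2⟩

theorem Heis.isBox {ε : ℝ} (m : MetricSpace Heis)
    (hd : ∀ p q : Heis, Heis.dist' m p q =
      max (Heis.enorm2 (q.h - p.h)) (ε * Real.sqrt |q.v - p.v - 2 * Heis.omega p.h q.h|)) :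
    IsBox Heis.hc Heis.v ε := by
  intro p q
  refine (hd p q).trans ?_
  have e : Heis.enorm2 (q.h - p.h) = ‖Heis.hc q - Heis.hc p‖ := by
    rw [Complex.norm_def, Complex.normSq_apply]
    simp only [Heis.enorm2, Heis.hc, Complex.sub_re, Complex.sub_im, Prod.fst_sub, Prod.snd_sub]
    congr 1; ring
  rw [e]
  rfl

theorem Heis.proper {ε : ℝ} (hε : 0 < ε) (m : MetricSpace Heis)
    (hd : ∀ p q : Heis, Heis.dist' m p q =
      max (Heis.enorm2 (q.h - p.h)) (ε * Real.sqrt |q.v - p.v - 2 * Heis.omega p.h q.h|)) :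
    ProperSpace Heis := by
  have hB := Heis.isBox m hd
  set ι : (ℝ × ℝ) × ℝ → Heis := fun x => x with hι
  have hcont : Continuous ι := by
    rw [continuous_iff_continuousAt]
    intro p
    rw [ContinuousAt, tendsto_iff_dist_tendsto_zero]
    have e : (fun x => dist (ι x) (ι p)) = fun x : (ℝ × ℝ) × ℝ =>
        max (Real.sqrt ((p.1.1 - x.1.1) ^ 2 + (p.1.2 - x.1.2) ^ 2))
          (ε * Real.sqrt |p.2 - x.2 - 2 * (x.1.1 * p.1.2 - x.1.2 * p.1.1)|) := by
      funext x
      exact hd (ι x) (ι p)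
    rw [e]
    have hc : Continuous fun x : (ℝ × ℝ) × ℝ =>
        max (Real.sqrt ((p.1.1 - x.1.1) ^ 2 + (p.1.2 - x.1.2) ^ 2))
          (ε * Real.sqrt |p.2 - x.2 - 2 * (x.1.1 * p.1.2 - x.1.2 * p.1.1)|) := by fun_prop
    have := hc.tendsto p
    have e0 : p.1.1 * p.1.2 - p.1.2 * p.1.1 = 0 := by ring
    simpa [e0] using this
  set o : Heis := ι ((0, 0), 0) with ho
  have hball : ∀ R, IsCompact (closedBall o R) := by
    intro R
    refine ((isCompact_closedBall ((0, 0), 0) (max R ((R / ε) ^ 2))).image hcont).of_isClosed_subset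
      isClosed_closedBall ?_
    intro q hq
    rw [mem_closedBall, dist_comm] at hq
    refine ⟨((q.h.1, q.h.2), q.v), ?_, rfl⟩
    have h1 := hB.norm_le o q
    have h2 := hB.vert_le hε o q
    have h3 : Heis.hc q - Heis.hc o = ⟨q.h.1, q.h.2⟩ := by
      apply Complex.ext <;> simp [Heis.hc, ho, hι, Heis.h]
    have h4 : Heis.v q - Heis.v o - 2 * om (Heis.hc o) (Heis.hc q) = q.v := by
      simp [om, Heis.hc, ho, hι, Heis.h, Heis.v]
    rw [h3] at h1
    rw [h4] at h2
    have a1 := Complex.abs_re_le_norm ⟨q.h.1, q.h.2⟩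
    have a2 := Complex.abs_im_le_norm ⟨q.h.1, q.h.2⟩
    have a3 : |q.v| ≤ (R / ε) ^ 2 := by
      rw [div_pow, le_div_iff₀ (by positivity)]
      have := pow_le_pow_left₀ dist_nonneg hq 2
      linarith
    have b1 : |q.h.1| ≤ R := a1.trans (h1.trans hq)
    have b2 : |q.h.2| ≤ R := a2.trans (h1.trans hq)
    rw [mem_closedBall, Prod.dist_eq, Prod.dist_eq, Real.dist_eq, Real.dist_eq, Real.dist_eq]
    simp only [sub_zero]
    exact max_le (max_le (b1.trans (le_max_left _ _)) (b2.trans (le_max_left _ _)))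
      (a3.trans (le_max_right _ _))
  constructor
  intro x R
  refine (hball (R + dist x o)).of_isClosed_subset isClosed_closedBall ?_
  exact closedBall_subset_closedBall' le_rfl

end Helpers

/-- There is `ε₀ > 0` such that for all `ε ∈ (0, ε₀]`: if `ℝ² × ℝ` is
endowed with the left-invariant smooth-box distance
`d(p,q) = max ‖q₁ - p₁‖ (ε √|q₂ - p₂ - 2ω(p₁,q₁)|)` of the first Heisenberg group,
and `E` is a Borel set with `0 < ℋᵅ(E) < ∞` whose `α`-density equals `1` at `ℋᵅ`-a.e.
point of `E`, then `α = 1` and `E` is covered, up to an `ℋ¹`-null set, by countably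
many Lipschitz images of compact subsets of `ℝ`. -/
theorem statement_3 :
    ∃ ε₀ : ℝ, 0 < ε₀ ∧ ∀ ε : ℝ, 0 < ε → ε ≤ ε₀ →
      ∀ m : MetricSpace Heis,
        (∀ p q : Heis, Heis.dist' m p q =
          max (Heis.enorm2 (q.h - p.h))
            (ε * Real.sqrt |q.v - p.v - 2 * Heis.omega p.h q.h|)) →
        ∀ α : ℝ, 0 < α → ∀ E : Set Heis,
          MeasurableSet[Heis.borelMS m] E →
          0 < Heis.hausdorff m α E → Heis.hausdorff m α E < ⊤ →
          (∀ᵐ x ∂((Heis.hausdorff m α).restrict E),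
            Tendsto
              (fun r : ℝ =>
                Heis.hausdorff m α (E ∩ Heis.cball m x r) / ENNReal.ofReal (2 * r) ^ α)
              (nhdsWithin 0 (Set.Ioi 0)) (nhds 1)) →
          α = 1 ∧
            ∃ (f : ℕ → ℝ → Heis) (A : ℕ → Set ℝ) (K : ℕ → ℝ≥0),
              (∀ i, IsCompact (A i)) ∧
              (∀ i, Heis.lipOn m (K i) (f i) (A i)) ∧
              Heis.hausdorff m 1 (E \ ⋃ i, f i '' A i) = 0 := by
  refine ⟨1 / 2, by norm_num, ?_⟩
  intro ε hε hε2 m hd α hα E hE hpos hfin hdens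
  let _ : MeasurableSpace Heis := Heis.borelMS m
  have _ : BorelSpace Heis := ⟨rfl⟩
  have _ : ProperSpace Heis := Heis.proper hε m hd
  exact main_abs (Heis.isBox m hd) hε hε2 hα hE hpos hfin hdens
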